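/- arXiv:1810.11323 — 2 statements merged into one kernel-verified Lean document; each statement's English description precedes it below -/
import Mathlib

section
/- Let n = 4k + 1 with k ≥ 1 an integer. Let q_1 be the permutation of {1,...,n} with q_1(1)=1, q_1(i)=i+1 for even i, q_1(i)=i−1 for odd i with 3 ≤ i ≤ n, and q_2 the permutation with q_2(n)=n, q_2(i)=i−1 for even i, q_2(i)=i+1 for odd i with 1 ≤ i ≤ n−2; let Q_1, Q_2 be their permutation matrices. Let O_n be the DFA with the three letters Ī_{(n−1)/2,(n+1)/2}, Q_1, Q_2, where Ī_{(n−1)/2,(n+1)/2} is the binary row-stochastic matrix of the map sending state (n−1)/2 to state (n+1)/2 and fixing every other state. Then O_n is synchronizing and the diameter of its square graph S(O_n) equals (n² + 3n − 8)/4. -/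
open Matrix

/-- The 0/1 matrix of a map on states `{1, ..., n}` described by `f : ℕ → ℕ`
(state `a` corresponds to the index `a.val + 1`): entry `(a, b)` is `1` iff
`f (a+1) = b+1` in the 1-indexed labels. -/
def matOfFun (n : ℕ) (f : ℕ → ℕ) : Matrix (Fin n) (Fin n) ℕ :=
  Matrix.of fun a b => if f (a.val + 1) = b.val + 1 then 1 else 0

/-- The permutation matrix of `q₁` with `q₁(1)=1`, `q₁(i)=i+1` for even `i`,
`q₁(i)=i−1` for odd `i` with `3 ≤ i ≤ n`. -/
def Q1mat (n : ℕ) : Matrix (Fin n) (Fin n) ℕ :=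
  matOfFun n fun s => if s = 1 then 1 else if s % 2 = 0 then s + 1 else s - 1

/-- The permutation matrix of `q₂` with `q₂(n)=n`, `q₂(i)=i−1` for even `i`,
`q₂(i)=i+1` for odd `i` with `1 ≤ i ≤ n−2`. -/
def Q2mat (n : ℕ) : Matrix (Fin n) (Fin n) ℕ :=
  matOfFun n fun s => if s = n then n else if s % 2 = 0 then s - 1 else s + 1

/-- The letter `Ī_{(n−1)/2,(n+1)/2}`: the row-stochastic matrix of the map sending state
`(n−1)/2` to state `(n+1)/2` and fixing every other state. -/
def IbarMat (n : ℕ) : Matrix (Fin n) (Fin n) ℕ :=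
  matOfFun n fun s => if s = (n - 1) / 2 then (n + 1) / 2 else s

/-- The DFA `O_n` on `n` states with the three letters `Ī_{(n−1)/2,(n+1)/2}, Q₁, Q₂`. -/
def On (n : ℕ) : Set (Matrix (Fin n) (Fin n) ℕ) :=
  {IbarMat n, Q1mat n, Q2mat n}

/-- A DFA (set of row-stochastic matrices) `S` is synchronizing: some nonempty product of
its matrices has an all-positive column. -/
def IsSync {n : ℕ} (S : Set (Matrix (Fin n) (Fin n) ℕ)) : Prop :=
  ∃ ws : List (Matrix (Fin n) (Fin n) ℕ), ws ≠ [] ∧ (∀ A ∈ ws, A ∈ S) ∧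
    ∃ j, ∀ i, 0 < ws.prod i j

/-- One edge of the square graph of the DFA `S`: the (unordered) pair `u` moves to the
pair `v` by some letter of `S`. -/
def sqStep {n : ℕ} (S : Set (Matrix (Fin n) (Fin n) ℕ))
    (u v : Fin n × Fin n) : Prop :=
  ∃ A ∈ S, (0 < A u.1 v.1 ∧ 0 < A u.2 v.2) ∨ (0 < A u.1 v.2 ∧ 0 < A u.2 v.1)

/-- `stepsTo r k u v`: there is a directed path of length `k` from `u` to `v` using the
edge relation `r`. -/
def stepsTo {V : Type*} (r : V → V → Prop) : ℕ → V → V → Prop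
  | 0, u, v => u = v
  | k + 1, u, v => ∃ w, r u w ∧ stepsTo r k w v

/-- The distance in the square graph from a vertex `u` to the nearest singleton. -/
noncomputable def sqDistToSingleton {n : ℕ} (S : Set (Matrix (Fin n) (Fin n) ℕ))
    (u : Fin n × Fin n) : ℕ :=
  sInf {k | ∃ s : Fin n, stepsTo (sqStep S) k u (s, s)}

/-- The diameter of the square graph of the DFA `S`: the maximum over non-singleton
vertices of the distance to the nearest singleton. -/
noncomputable def sqDiam {n : ℕ} (S : Set (Matrix (Fin n) (Fin n) ℕ)) : ℕ :=
  sSup {d | ∃ u : Fin n × Fin n, u.1 ≠ u.2 ∧ sqDistToSingleton S u = d}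


/-- Doubled cyclic coordinate of the state `s`. -/
def cX (s : ℕ) : ℤ := if s % 2 = 0 then (s : ℤ) else 1 - (s : ℤ)

/-- The position `p` with `2 * cX p ≡ j` modulo `4k+1`. -/
def cT (k j : ℕ) : ℕ :=
  if j = 0 then 1 else if j % 4 = 0 then j / 2 else if j % 4 = 1 then 2 * k + 1 - 2 * (j / 4)
  else if j % 4 = 2 then 4 * k + 1 - 2 * (j / 4) else 2 * k + 2 + 2 * (j / 4)

/-- The exact distance of a pair of level `e` and position `p`. -/
def cF (k : ℕ) : ℕ → ℕ → ℕ
  | 0, _ => 0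
  | e + 1, p => ((p : ℤ) - (cT k e : ℤ)).natAbs + 1 + cF k e (cT k (e + 1))

/-- The pair `a, b` has level `e` and position `p`. -/
def cR (k a b e p : ℕ) : Prop :=
  1 ≤ p ∧ p ≤ 4 * k + 1 ∧ e ≤ 2 * k ∧
  ((4 * (k : ℤ) + 1) ∣ cX a - cX b - e ∨ (4 * (k : ℤ) + 1) ∣ cX a - cX b + e) ∧
  (4 * (k : ℤ) + 1) ∣ cX a + cX b - 2 * cX p

/-- first reflection -/
def cq1 (s : ℕ) : ℕ := if s = 1 then 1 else if s % 2 = 0 then s + 1 else s - 1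
/-- second reflection -/
def cq2 (n s : ℕ) : ℕ := if s = n then n else if s % 2 = 0 then s - 1 else s + 1
/-- merging letter -/
def cI (n s : ℕ) : ℕ := if s = (n - 1) / 2 then (n + 1) / 2 else s

lemma cX_q1 (s : ℕ) (h : 1 ≤ s) : cX (cq1 s) = - cX s := by
  generalize hp : cq1 s = p
  unfold cq1 at hp; unfold cX; split_ifs at hp ⊢ <;> omega

lemma cX_q2 (k s : ℕ) (h : 1 ≤ s) (h2 : s ≤ 4 * k + 1) :
    (4 * (k : ℤ) + 1) ∣ cX (cq2 (4 * k + 1) s) + cX s - 2 := by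
  by_cases hs : s = 4 * k + 1
  · refine ⟨-2, ?_⟩
    generalize hp : cq2 (4 * k + 1) s = p
    unfold cq2 at hp; unfold cX; split_ifs at hp ⊢ <;> omega
  · refine ⟨0, ?_⟩
    generalize hp : cq2 (4 * k + 1) s = p
    unfold cq2 at hp; unfold cX; split_ifs at hp ⊢ <;> omega

lemma cX_inj (k a b : ℕ) (ha : 1 ≤ a) (ha2 : a ≤ 4 * k + 1) (hb : 1 ≤ b) (hb2 : b ≤ 4 * k + 1)
    (h : (4 * (k : ℤ) + 1) ∣ cX a - cX b) : a = b := by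
  obtain ⟨c, hc⟩ := h
  have h1 : c < 2 := by
    by_contra hcon
    have : (4 * (k : ℤ) + 1) * 2 ≤ (4 * (k : ℤ) + 1) * c :=
      mul_le_mul_of_nonneg_left (by omega) (by omega)
    unfold cX at hc; split_ifs at hc <;> omega
  have h2 : -2 < c := by
    by_contra hcon
    have : (4 * (k : ℤ) + 1) * c ≤ (4 * (k : ℤ) + 1) * (-2) :=
      mul_le_mul_of_nonneg_left (by omega) (by omega)
    unfold cX at hc; split_ifs at hc <;> omega
  have h3 : c = -1 ∨ c = 0 ∨ c = 1 := by omega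
  unfold cX at hc
  rcases h3 with rfl | rfl | rfl <;> split_ifs at hc <;> omega

lemma dvd_half (k : ℕ) (z : ℤ) (h : (4 * (k : ℤ) + 1) ∣ 2 * z) : (4 * (k : ℤ) + 1) ∣ z := by
  obtain ⟨c, hc⟩ := h
  exact ⟨z - 2 * k * c, by linear_combination (-2 * (k : ℤ)) * hc⟩

lemma cT_range (k j : ℕ) (hk : 1 ≤ k) (hj : j ≤ 2 * k) : 1 ≤ cT k j ∧ cT k j ≤ 4 * k + 1 := by
  unfold cT; split_ifs <;> omega

lemma cT_spec (k j : ℕ) (hj : j ≤ 2 * k) :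
    (4 * (k : ℤ) + 1) ∣ 2 * cX (cT k j) - j := by
  have h4 : j % 4 = 0 ∨ j % 4 = 1 ∨ j % 4 = 2 ∨ j % 4 = 3 := by omega
  rcases h4 with h | h | h | h
  · refine ⟨0, ?_⟩
    generalize hp : cT k j = p
    unfold cT at hp; unfold cX; split_ifs at hp ⊢ <;> omega
  · refine ⟨-1, ?_⟩
    generalize hp : cT k j = p
    unfold cT at hp; unfold cX; split_ifs at hp ⊢ <;> omega
  · refine ⟨-2, ?_⟩
    generalize hp : cT k j = p
    unfold cT at hp; unfold cX; split_ifs at hp ⊢ <;> omega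
  · refine ⟨1, ?_⟩
    generalize hp : cT k j = p
    unfold cT at hp; unfold cX; split_ifs at hp ⊢ <;> omega

lemma cT_uniq (k j p : ℕ) (hk : 1 ≤ k) (hj : j ≤ 2 * k) (h1 : 1 ≤ p) (h2 : p ≤ 4 * k + 1)
    (h : (4 * (k : ℤ) + 1) ∣ 2 * cX p - j) : p = cT k j := by
  obtain ⟨h3, h4⟩ := cT_range k j hk hj
  apply cX_inj k _ _ h1 h2 h3 h4
  apply dvd_half
  obtain ⟨c, h⟩ := h
  obtain ⟨c', h'⟩ := cT_spec k j hj
  exact ⟨c - c', by linear_combination h - h'⟩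

lemma cq1_range (k s : ℕ) (h : 1 ≤ s) (h2 : s ≤ 4 * k + 1) : 1 ≤ cq1 s ∧ cq1 s ≤ 4 * k + 1 := by
  unfold cq1; split_ifs <;> omega

lemma cq2_range (k s : ℕ) (h : 1 ≤ s) (h2 : s ≤ 4 * k + 1) :
    1 ≤ cq2 (4 * k + 1) s ∧ cq2 (4 * k + 1) s ≤ 4 * k + 1 := by
  unfold cq2; split_ifs <;> omega

lemma cI_range (k s : ℕ) (h : 1 ≤ s) (h2 : s ≤ 4 * k + 1) :
    1 ≤ cI (4 * k + 1) s ∧ cI (4 * k + 1) s ≤ 4 * k + 1 := by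
  unfold cI; split_ifs <;> omega

lemma cR_symm {k a b e p : ℕ} (h : cR k a b e p) : cR k b a e p := by
  obtain ⟨h1, h2, h3, h4, h5⟩ := h
  refine ⟨h1, h2, h3, ?_, by obtain ⟨c, h⟩ := h5; exact ⟨c, by linear_combination h⟩⟩
  rcases h4 with h | h
  · right; obtain ⟨c, hc⟩ := h; exact ⟨-c, by linear_combination -hc⟩
  · left; obtain ⟨c, hc⟩ := h; exact ⟨-c, by linear_combination -hc⟩

lemma cR_q1 {k a b e p : ℕ} (ha : 1 ≤ a) (hb : 1 ≤ b) (h : cR k a b e p) :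
    cR k (cq1 a) (cq1 b) e (cq1 p) := by
  obtain ⟨h1, h2, h3, h4, h5⟩ := h
  obtain ⟨h6, h7⟩ := cq1_range k p h1 h2
  refine ⟨h6, h7, h3, ?_, ?_⟩
  · rw [cX_q1 a ha, cX_q1 b hb]
    rcases h4 with h | h
    · right; obtain ⟨c, hc⟩ := h; exact ⟨-c, by linear_combination -hc⟩
    · left; obtain ⟨c, hc⟩ := h; exact ⟨-c, by linear_combination -hc⟩
  · rw [cX_q1 a ha, cX_q1 b hb, cX_q1 p h1]
    obtain ⟨c, hc⟩ := h5; exact ⟨-c, by linear_combination -hc⟩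

lemma cR_q2 {k a b e p : ℕ} (ha : 1 ≤ a) (ha2 : a ≤ 4 * k + 1) (hb : 1 ≤ b) (hb2 : b ≤ 4 * k + 1)
    (h : cR k a b e p) :
    cR k (cq2 (4 * k + 1) a) (cq2 (4 * k + 1) b) e (cq2 (4 * k + 1) p) := by
  obtain ⟨h1, h2, h3, h4, h5⟩ := h
  obtain ⟨h6, h7⟩ := cq2_range k p h1 h2
  obtain ⟨ca, hca⟩ := cX_q2 k a ha ha2
  obtain ⟨cb, hcb⟩ := cX_q2 k b hb hb2
  obtain ⟨cp, hcp⟩ := cX_q2 k p h1 h2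
  obtain ⟨c5, h5⟩ := h5
  refine ⟨h6, h7, h3, ?_, ⟨ca + cb - 2 * cp - c5, by linear_combination hca + hcb - 2 * hcp - h5⟩⟩
  rcases h4 with ⟨c, h⟩ | ⟨c, h⟩
  · right; exact ⟨ca - cb - c, by linear_combination hca - hcb - h⟩
  · left; exact ⟨ca - cb - c, by linear_combination hca - hcb - h⟩

lemma cX_mid (k : ℕ) : cX (2 * k) = 2 * k := by
  unfold cX; split_ifs <;> omega

lemma cI_mid (k : ℕ) : cI (4 * k + 1) (2 * k) = 2 * k + 1 := by
  unfold cI; split_ifs <;> omega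

lemma cX_mid' (k : ℕ) : cX (2 * k + 1) = - (2 * k) := by
  unfold cX; split_ifs <;> omega

lemma cI_ne (k s : ℕ) (h : s ≠ 2 * k) : cI (4 * k + 1) s = s := by
  unfold cI; split_ifs <;> omega

/-- going down one level -/
lemma cR_down {k b e p : ℕ} (hk : 1 ≤ k) (he : e + 1 ≤ 2 * k)
    (h : cR k (2 * k) b (e + 1) p)
    (hd : (4 * (k : ℤ) + 1) ∣ cX (2 * k) - cX b + ((e + 1 : ℕ) : ℤ)) :
    p = cT k e ∧ cR k (2 * k + 1) b e (cT k (e + 1)) := by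
  obtain ⟨h1, h2, h3, -, h5⟩ := h
  rw [cX_mid] at hd h5
  obtain ⟨c, hc⟩ := hd
  obtain ⟨c5, h5⟩ := h5
  push_cast at hc
  obtain ⟨h6, h7⟩ := cT_range k (e + 1) hk he
  obtain ⟨ct, hct⟩ := cT_spec k (e + 1) he
  push_cast at hct
  constructor
  · apply cT_uniq k e p hk (by omega) h1 h2
    exact ⟨1 - c5 - c, by linear_combination -h5 - hc⟩
  · refine ⟨h6, h7, by omega, ?_, ?_⟩
    · right; rw [cX_mid']; exact ⟨c - 1, by linear_combination hc⟩
    · rw [cX_mid']; exact ⟨-c - ct, by linear_combination -hc - hct⟩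

lemma cF_lip (k e p p' : ℕ) (h : p ≤ p' + 1) (h' : p' ≤ p + 1) : cF k e p ≤ cF k e p' + 1 := by
  cases e with
  | zero => simp [cF]
  | succ e => simp only [cF]; omega

lemma cq1_near (s : ℕ) : s ≤ cq1 s + 1 ∧ cq1 s ≤ s + 1 := by
  unfold cq1; split_ifs <;> omega

lemma cq2_near (n s : ℕ) : s ≤ cq2 n s + 1 ∧ cq2 n s ≤ s + 1 := by
  unfold cq2; split_ifs <;> omega

/-- going up one level -/
lemma cR_up {k b e p : ℕ} (hk : 1 ≤ k)
    (h : cR k (2 * k) b e p)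
    (hd : (4 * (k : ℤ) + 1) ∣ cX (2 * k) - cX b - (e : ℤ)) :
    ∃ e' p', cR k (2 * k + 1) b e' p' ∧ cF k e p ≤ cF k e' p' + 1 := by
  obtain ⟨h1, h2, h3, -, h5⟩ := h
  rw [cX_mid] at hd h5
  obtain ⟨c, hc⟩ := hd
  obtain ⟨c5, h5⟩ := h5
  rcases Nat.lt_or_ge e (2 * k) with he | he
  · refine ⟨e + 1, cq1 (cT k e), ?_, ?_⟩
    · obtain ⟨h6, h7⟩ := cT_range k e hk (by omega)
      obtain ⟨h8, h9⟩ := cq1_range k _ h6 h7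
      obtain ⟨ct, hct⟩ := cT_spec k e (by omega)
      refine ⟨h8, h9, by omega, ?_, ?_⟩
      · left; rw [cX_mid']; push_cast; exact ⟨c - 1, by linear_combination hc⟩
      · rw [cX_mid', cX_q1 _ h6]; exact ⟨-c + ct, by linear_combination -hc + hct⟩
    · have hq : cq1 p = cT k (e + 1) := by
        obtain ⟨h8, h9⟩ := cq1_range k p h1 h2
        apply cT_uniq k (e + 1) _ hk (by omega) h8 h9
        rw [cX_q1 p h1]; push_cast
        exact ⟨c + c5 - 1, by linear_combination hc + h5⟩
      have h10 := cq1_near p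
      have := cF_lip k e p (cq1 p) h10.1 h10.2
      rw [hq] at this
      have h11 : cF k (e + 1) (cq1 (cT k e)) ≥ cF k e (cT k (e + 1)) + 1 := by
        simp only [cF]; omega
      omega
  · have he : e = 2 * k := by omega
    have hez : (e : ℤ) = 2 * k := by omega
    rw [hez] at hc
    have h10 := cq1_near p
    obtain ⟨h8, h9⟩ := cq1_range k p h1 h2
    refine ⟨e, cq1 p, ⟨h8, h9, h3, ?_, ?_⟩, cF_lip k e p (cq1 p) h10.1 h10.2⟩
    · right; rw [cX_mid', hez]; exact ⟨c, by linear_combination hc⟩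
    · rw [cX_mid', cX_q1 _ h1]
      exact ⟨-2 * c - c5, by linear_combination -2 * hc - h5⟩

lemma cR_I1 {k b e p : ℕ} (hk : 1 ≤ k) (h : cR k (2 * k) b e p) :
    cF k e p = 0 ∨ ∃ e' p', cR k (2 * k + 1) b e' p' ∧ cF k e p ≤ cF k e' p' + 1 := by
  cases e with
  | zero => left; simp [cF]
  | succ e =>
    right
    rcases h.2.2.2.1 with hd | hd
    · exact cR_up hk h hd
    · have he := h.2.2.1
      obtain ⟨hp, hr⟩ := cR_down hk he h hd
      refine ⟨_, _, hr, ?_⟩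
      subst hp
      simp [cF]; omega

lemma cR_eq {k a b e p : ℕ} (ha : 1 ≤ a) (ha2 : a ≤ 4 * k + 1) (hb : 1 ≤ b) (hb2 : b ≤ 4 * k + 1)
    (h : cR k a b e p) : a = b ↔ e = 0 := by
  constructor
  · rintro rfl
    have he := h.2.2.1
    have hd : (4 * (k : ℤ) + 1) ∣ (e : ℤ) := by
      rcases h.2.2.2.1 with hd | hd
      · obtain ⟨c, hc⟩ := hd; exact ⟨-c, by linear_combination -hc⟩
      · obtain ⟨c, hc⟩ := hd; exact ⟨c, by linear_combination hc⟩
    have := Int.eq_zero_of_dvd_of_nonneg_of_lt (by omega) (by omega) hd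
    omega
  · rintro rfl
    apply cX_inj k a b ha ha2 hb hb2
    rcases h.2.2.2.1 with hd | hd <;> simpa using hd

lemma cR_I {k a b e p : ℕ} (hk : 1 ≤ k) (ha : 1 ≤ a) (ha2 : a ≤ 4 * k + 1) (hb : 1 ≤ b)
    (hb2 : b ≤ 4 * k + 1) (h : cR k a b e p) :
    cF k e p = 0 ∨ ∃ e' p', cR k (cI (4 * k + 1) a) (cI (4 * k + 1) b) e' p' ∧
      cF k e p ≤ cF k e' p' + 1 := by
  by_cases hab : a = b
  · left
    rw [(cR_eq ha ha2 hb hb2 h).1 hab]; simp [cF]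
  by_cases h1 : a = 2 * k
  · subst h1
    rw [cI_mid, cI_ne k b (Ne.symm hab)]
    exact cR_I1 hk h
  by_cases h2 : b = 2 * k
  · subst h2
    rw [cI_mid, cI_ne k a hab]
    rcases cR_I1 hk (cR_symm h) with h | ⟨e', p', h, h'⟩
    · exact Or.inl h
    · exact Or.inr ⟨e', p', cR_symm h, h'⟩
  · rw [cI_ne k a h1, cI_ne k b h2]
    exact Or.inr ⟨e, p, h, by omega⟩

lemma cR_exists (k a b : ℕ) (hk : 1 ≤ k) : ∃ e p, cR k a b e p := by
  have hn : (0 : ℤ) < 4 * (k : ℤ) + 1 := by omega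
  have he : ∃ e : ℕ, e ≤ 2 * k ∧
    ((4 * (k : ℤ) + 1) ∣ cX a - cX b - e ∨ (4 * (k : ℤ) + 1) ∣ cX a - cX b + e) := by
    have e1 := Int.emod_add_mul_ediv (cX a - cX b) (4 * (k : ℤ) + 1)
    have e2 := Int.emod_nonneg (cX a - cX b) hn.ne'
    have e3 := Int.emod_lt_of_pos (cX a - cX b) hn
    set r := (cX a - cX b) % (4 * (k : ℤ) + 1)
    set q := (cX a - cX b) / (4 * (k : ℤ) + 1)
    by_cases hr : r ≤ 2 * k
    · refine ⟨r.toNat, by omega, Or.inl ⟨q, ?_⟩⟩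
      rw [Int.toNat_of_nonneg e2]; linear_combination -e1
    · refine ⟨(4 * k + 1 - r).toNat, by omega, Or.inr ⟨q + 1, ?_⟩⟩
      rw [Int.toNat_of_nonneg (by omega)]; linear_combination -e1
  have hp : ∃ p : ℕ, 1 ≤ p ∧ p ≤ 4 * k + 1 ∧ (4 * (k : ℤ) + 1) ∣ cX a + cX b - 2 * cX p := by
    have hS : ∃ z, cX a + cX b = 2 * z := by
      have : ∀ s, cX s % 2 = 0 := by intro s; unfold cX; split_ifs <;> omega
      have h1 := this a
      have h2 := this b
      exact ⟨(cX a + cX b) / 2, by omega⟩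
    obtain ⟨z, hz⟩ := hS
    rw [hz]
    have e1 := Int.emod_add_mul_ediv z (4 * (k : ℤ) + 1)
    have e2 := Int.emod_nonneg z hn.ne'
    have e3 := Int.emod_lt_of_pos z hn
    set r := z % (4 * (k : ℤ) + 1)
    set q := z / (4 * (k : ℤ) + 1)
    by_cases h0 : r = 0
    · refine ⟨1, by omega, by omega, 2 * q, ?_⟩
      have : cX 1 = 0 := by simp [cX]
      rw [this]; linear_combination 2 * h0 - 2 * e1
    by_cases h1 : r % 2 = 0
    · refine ⟨r.toNat, by omega, by omega, 2 * q, ?_⟩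
      have : cX r.toNat = r := by unfold cX; split_ifs <;> omega
      rw [this]; linear_combination -2 * e1
    · refine ⟨(4 * k + 2 - r).toNat, by omega, by omega, 2 * q + 2, ?_⟩
      have : cX (4 * k + 2 - r).toNat = r - (4 * k + 1) := by unfold cX; split_ifs <;> omega
      rw [this]; linear_combination -2 * e1
  obtain ⟨e, he1, he2⟩ := he
  obtain ⟨p, hp1, hp2, hp3⟩ := hp
  exact ⟨e, p, hp1, hp2, he1, he2, hp3⟩

/-- A letter decreasing the potential by exactly one. -/
lemma cR_good {k a b e p l : ℕ} (hk : 1 ≤ k) (ha : 1 ≤ a) (ha2 : a ≤ 4 * k + 1) (hb : 1 ≤ b)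
    (hb2 : b ≤ 4 * k + 1) (h : cR k a b e p) (hl : cF k e p = l + 1) :
    ∃ f ∈ ({cI (4 * k + 1), cq1, cq2 (4 * k + 1)} : Set (ℕ → ℕ)), ∃ e' p',
      cR k (f a) (f b) e' p' ∧ cF k e' p' = l := by
  cases e with
  | zero => simp [cF] at hl
  | succ e =>
    have he := h.2.2.1
    have hp1 := h.1
    have hp2 := h.2.1
    obtain ⟨t1, t2⟩ := cT_range k e hk (by omega)
    simp only [cF] at hl
    by_cases hp : p = cT k e
    · refine ⟨cI (4 * k + 1), by simp, e, cT k (e + 1), ?_, by omega⟩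
      have key : ∀ a b : ℕ, 1 ≤ a → a ≤ 4 * k + 1 → 1 ≤ b → b ≤ 4 * k + 1 →
          cR k a b (e + 1) p → (4 * (k : ℤ) + 1) ∣ cX a - cX b + ((e + 1 : ℕ) : ℤ) →
          cR k (cI (4 * k + 1) a) (cI (4 * k + 1) b) e (cT k (e + 1)) := by
        intro a b ha ha2 hb hb2 h hd
        have hab : a ≠ b := fun hab => by
          have := (cR_eq ha ha2 hb hb2 h).1 hab
          omega
        have ham : a = 2 * k := by
          apply cX_inj k a (2 * k) ha ha2 (by omega) (by omega)
          apply dvd_half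
          rw [cX_mid]
          obtain ⟨c, hc⟩ := hd
          obtain ⟨c5, h5⟩ := h.2.2.2.2
          obtain ⟨ct, hct⟩ := cT_spec k e (by omega)
          rw [hp] at h5
          push_cast at hc
          exact ⟨c + c5 + ct - 1, by linear_combination hc + h5 + hct⟩
        subst ham
        rw [cI_mid, cI_ne k b (Ne.symm hab)]
        exact (cR_down hk he h hd).2
      rcases h.2.2.2.1 with hd | hd
      · apply cR_symm
        apply key b a hb hb2 ha ha2 (cR_symm h)
        obtain ⟨c, hc⟩ := hd; exact ⟨-c, by linear_combination -hc⟩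
      · exact key a b ha ha2 hb hb2 h hd
    · have hq : ((cq1 p : ℤ) - cT k e).natAbs + 1 = ((p : ℤ) - cT k e).natAbs ∨
          ((cq2 (4 * k + 1) p : ℤ) - cT k e).natAbs + 1 = ((p : ℤ) - cT k e).natAbs := by
        unfold cq1 cq2
        split_ifs <;> omega
      rcases hq with hq | hq
      · exact ⟨cq1, by simp, e + 1, cq1 p, cR_q1 ha hb h, by simp only [cF]; omega⟩
      · exact ⟨cq2 (4 * k + 1), by simp, e + 1, cq2 (4 * k + 1) p, cR_q2 ha ha2 hb hb2 h,
          by simp only [cF]; omega⟩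

lemma matOfFun_pos (n : ℕ) (f : ℕ → ℕ) (a b : Fin n) :
    0 < matOfFun n f a b ↔ f (a.val + 1) = b.val + 1 := by
  unfold matOfFun
  simp only [Matrix.of_apply]
  split_ifs <;> simp_all

lemma On_iff (n : ℕ) (A : Matrix (Fin n) (Fin n) ℕ) :
    A ∈ On n ↔ ∃ f ∈ ({cI n, cq1, cq2 n} : Set (ℕ → ℕ)), A = matOfFun n f := by
  simp only [Set.mem_insert_iff, Set.mem_singleton_iff, exists_eq_or_imp, exists_eq_left]
  rfl

lemma letter_range (k s : ℕ) (f : ℕ → ℕ)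
    (hf : f ∈ ({cI (4 * k + 1), cq1, cq2 (4 * k + 1)} : Set (ℕ → ℕ)))
    (h : 1 ≤ s) (h2 : s ≤ 4 * k + 1) : 1 ≤ f s ∧ f s ≤ 4 * k + 1 := by
  rcases hf with rfl | rfl | rfl
  · exact cI_range k s h h2
  · exact cq1_range k s h h2
  · exact cq2_range k s h h2

lemma letter_fun (k : ℕ) (f : ℕ → ℕ)
    (hf : f ∈ ({cI (4 * k + 1), cq1, cq2 (4 * k + 1)} : Set (ℕ → ℕ))) :
    ∃ g : Fin (4 * k + 1) → Fin (4 * k + 1), ∀ i, f (i.val + 1) = (g i).val + 1 := by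
  have hr : ∀ i : Fin (4 * k + 1), 1 ≤ f (i.val + 1) ∧ f (i.val + 1) ≤ 4 * k + 1 :=
    fun i => letter_range k _ f hf (by omega) (by omega)
  refine ⟨fun i => ⟨f (i.val + 1) - 1, by have := hr i; omega⟩, fun i => ?_⟩
  have := hr i
  simp only; omega

lemma upper (k : ℕ) (hk : 1 ≤ k) : ∀ (l e p : ℕ) (a b : Fin (4 * k + 1)),
    cR k (a.val + 1) (b.val + 1) e p → cF k e p = l →
    ∃ s, stepsTo (sqStep (On (4 * k + 1))) l (a, b) (s, s) := by
  intro l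
  induction l with
  | zero =>
    intro e p a b h hl
    have he : e = 0 := by
      cases e with
      | zero => rfl
      | succ e => simp only [cF] at hl; omega
    have := (cR_eq (by omega) (by omega) (by omega) (by omega) h).2 he
    have hab : a = b := by ext; omega
    exact ⟨b, by simp [stepsTo, hab]⟩
  | succ l ih =>
    intro e p a b h hl
    obtain ⟨f, hf, e', p', h1, h2⟩ := cR_good hk (by omega) (by omega) (by omega) (by omega) h hl
    obtain ⟨g, hg⟩ := letter_fun k f hf
    rw [hg, hg] at h1
    obtain ⟨s, hs⟩ := ih e' p' (g a) (g b) h1 h2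
    refine ⟨s, (g a, g b), ⟨matOfFun _ f, (On_iff _ _).2 ⟨f, hf, rfl⟩, Or.inl ⟨?_, ?_⟩⟩, hs⟩
    · exact (matOfFun_pos _ _ _ _).2 (hg a)
    · exact (matOfFun_pos _ _ _ _).2 (hg b)

lemma cR_letter {k a b e p : ℕ} (hk : 1 ≤ k) (ha : 1 ≤ a) (ha2 : a ≤ 4 * k + 1) (hb : 1 ≤ b)
    (hb2 : b ≤ 4 * k + 1) (h : cR k a b e p) (f : ℕ → ℕ)
    (hf : f ∈ ({cI (4 * k + 1), cq1, cq2 (4 * k + 1)} : Set (ℕ → ℕ))) :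
    cF k e p = 0 ∨ ∃ e' p', cR k (f a) (f b) e' p' ∧ cF k e p ≤ cF k e' p' + 1 := by
  rcases hf with rfl | rfl | rfl
  · exact cR_I hk ha ha2 hb hb2 h
  · have := cq1_near p
    exact Or.inr ⟨e, _, cR_q1 ha hb h, cF_lip k e _ _ this.1 this.2⟩
  · have := cq2_near (4 * k + 1) p
    exact Or.inr ⟨e, _, cR_q2 ha ha2 hb hb2 h, cF_lip k e _ _ this.1 this.2⟩

lemma lower (k : ℕ) (hk : 1 ≤ k) : ∀ (l e p : ℕ) (u : Fin (4 * k + 1) × Fin (4 * k + 1))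
    (s : Fin (4 * k + 1)),
    cR k (u.1.val + 1) (u.2.val + 1) e p →
    stepsTo (sqStep (On (4 * k + 1))) l u (s, s) → cF k e p ≤ l := by
  intro l
  induction l with
  | zero =>
    intro e p u s h hs
    simp only [stepsTo] at hs
    subst hs
    rw [(cR_eq (by omega) (by omega) (by omega) (by omega) h).1 rfl]
    simp [cF]
  | succ l ih =>
    intro e p u s h hs
    obtain ⟨v, ⟨A, hA, hv⟩, hs⟩ := hs
    obtain ⟨f, hf, rfl⟩ := (On_iff _ _).1 hA
    simp only [matOfFun_pos] at hv
    rcases cR_letter hk (by omega) (by omega) (by omega) (by omega) h f hf with h0 | ⟨e', p', h1, h2⟩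
    · omega
    · have : cR k (v.1.val + 1) (v.2.val + 1) e' p' := by
        rcases hv with ⟨h3, h4⟩ | ⟨h3, h4⟩
        · rwa [h3, h4] at h1
        · rw [h3, h4] at h1; exact cR_symm h1
      have := ih e' p' v s this hs
      omega

lemma dist_eq (k : ℕ) (hk : 1 ≤ k) (e p : ℕ) (u : Fin (4 * k + 1) × Fin (4 * k + 1))
    (h : cR k (u.1.val + 1) (u.2.val + 1) e p) :
    sqDistToSingleton (On (4 * k + 1)) u = cF k e p := by
  unfold sqDistToSingleton
  have hu := upper k hk _ e p u.1 u.2 h rfl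
  apply le_antisymm
  · exact Nat.sInf_le hu
  · have hne : {l | ∃ s, stepsTo (sqStep (On (4 * k + 1))) l u (s, s)}.Nonempty := ⟨_, hu⟩
    obtain ⟨s, hs⟩ := Nat.sInf_mem hne
    exact lower k hk _ e p u s h hs

/-- total cost from the landing point -/
def cG (k e : ℕ) : ℕ := cF k e (cT k (e + 1))

lemma cG_succ (k e : ℕ) :
    cG k (e + 1) = ((cT k (e + 2) : ℤ) - cT k e).natAbs + 1 + cG k e := by
  simp [cG, cF]

lemma cG_mono (k : ℕ) : Monotone (cG k) := by
  apply monotone_nat_of_le_succ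
  intro e; rw [cG_succ]; omega

lemma cT_0 (k t : ℕ) (h : 1 ≤ t) : cT k (4 * t) = 2 * t := by
  unfold cT; split_ifs <;> omega
lemma cT_1 (k t : ℕ) : cT k (4 * t + 1) = 2 * k + 1 - 2 * t := by
  unfold cT
  rw [if_neg (by omega), if_neg (by omega), if_pos (by omega)]
  omega
lemma cT_2 (k t : ℕ) : cT k (4 * t + 2) = 4 * k + 1 - 2 * t := by
  unfold cT
  rw [if_neg (by omega), if_neg (by omega), if_neg (by omega), if_pos (by omega)]
  omega
lemma cT_3 (k t : ℕ) : cT k (4 * t + 3) = 2 * k + 2 + 2 * t := by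
  unfold cT
  rw [if_neg (by omega), if_neg (by omega), if_neg (by omega), if_neg (by omega)]
  omega

lemma cT_diff_even (k m : ℕ) (h1 : 1 ≤ m) (hm : m + 1 ≤ k) :
    ((cT k (2 * m + 2) : ℤ) - cT k (2 * m)).natAbs = 4 * k + 1 - 2 * m := by
  obtain ⟨t, rfl | rfl⟩ := Nat.even_or_odd' m
  · have e1 : 2 * (2 * t) + 2 = 4 * t + 2 := by ring
    have e2 : 2 * (2 * t) = 4 * t := by ring
    rw [e1, e2, cT_2, cT_0 k t (by omega)]
    omega
  · have e1 : 2 * (2 * t + 1) + 2 = 4 * (t + 1) := by ring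
    have e2 : 2 * (2 * t + 1) = 4 * t + 2 := by ring
    rw [e1, e2, cT_2, cT_0 k (t + 1) (by omega)]
    omega

lemma cT_diff_odd (k m : ℕ) (hm : m + 1 ≤ k) :
    ((cT k (2 * m + 1 + 2) : ℤ) - cT k (2 * m + 1)).natAbs = 2 * m + 1 := by
  obtain ⟨t, rfl | rfl⟩ := Nat.even_or_odd' m
  · have e1 : 2 * (2 * t) + 1 + 2 = 4 * t + 3 := by ring
    have e2 : 2 * (2 * t) + 1 = 4 * t + 1 := by ring
    rw [e1, e2, cT_3, cT_1]
    omega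
  · have e1 : 2 * (2 * t + 1) + 1 + 2 = 4 * (t + 1) + 1 := by ring
    have e2 : 2 * (2 * t + 1) + 1 = 4 * t + 3 := by ring
    rw [e1, e2, cT_3, cT_1]
    omega

lemma cG_even (k m : ℕ) (hm : m + 1 ≤ k) (h1 : 1 ≤ m) :
    cG k (2 * m) + 1 = m * (4 * k + 4) := by
  induction m, h1 using Nat.le_induction with
  | base =>
    have h0 : cG k 0 = 0 := by simp [cG, cF]
    have e1 : ((cT k 2 : ℤ) - cT k 0).natAbs = 4 * k := by simp [cT]; omega
    have e2 : ((cT k 3 : ℤ) - cT k 1).natAbs = 1 := by simp [cT]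
    have s1 := cG_succ k 0
    have s2 := cG_succ k 1
    norm_num only at s1 s2 ⊢
    omega
  | succ m h1 ih =>
    have ih := ih (by omega)
    have e1 : ((cT k (2 * m + 2) : ℤ) - cT k (2 * m)).natAbs = 4 * k + 1 - 2 * m :=
      cT_diff_even k m (by omega) (by omega)
    have e2 : ((cT k (2 * m + 1 + 2) : ℤ) - cT k (2 * m + 1)).natAbs = 2 * m + 1 :=
      cT_diff_odd k m (by omega)
    have s1 := cG_succ k (2 * m)
    have s2 := cG_succ k (2 * m + 1)
    have : 2 * (m + 1) = 2 * m + 1 + 1 := by ring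
    rw [this, s2, s1, e1, e2, add_mul, ← ih]
    omega

lemma cG_last (k : ℕ) (hk : 1 ≤ k) : cG k (2 * k - 1) + 1 = 4 * k ^ 2 + 2 * k := by
  obtain ⟨m, rfl⟩ : ∃ m, k = m + 1 := ⟨k - 1, by omega⟩
  have e : 2 * (m + 1) - 1 = 2 * m + 1 := by omega
  rw [e, cG_succ]
  rcases Nat.eq_zero_or_pos m with rfl | hm
  · simp [cG, cF, cT]
  · have h := cG_even (m + 1) m le_rfl hm
    have e1 : ((cT (m + 1) (2 * m + 2) : ℤ) - cT (m + 1) (2 * m)).natAbs = 4 * (m + 1) + 1 - 2 * m :=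
      cT_diff_even (m + 1) m (by omega) (by omega)
    rw [e1]
    have : 4 * (m + 1) + 1 - 2 * m = 2 * m + 5 := by omega
    rw [this]
    linear_combination h

lemma cG_prev (k : ℕ) (hk : 1 ≤ k) : cG k (2 * k - 2) + 2 ≤ 4 * k ^ 2 + k := by
  obtain ⟨m, rfl⟩ : ∃ m, k = m + 1 := ⟨k - 1, by omega⟩
  have e : 2 * (m + 1) - 2 = 2 * m := by omega
  rw [e]
  rcases Nat.eq_zero_or_pos m with rfl | hm
  · simp [cG, cF]
  · have h := cG_even (m + 1) m le_rfl hm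
    nlinarith

lemma cF_le (k e p : ℕ) (hk : 1 ≤ k) (he : e ≤ 2 * k) (h1 : 1 ≤ p) (h2 : p ≤ 4 * k + 1) :
    cF k e p + 1 ≤ 4 * k ^ 2 + 5 * k := by
  cases e with
  | zero => simp only [cF]; nlinarith
  | succ e =>
    have hF : cF k (e + 1) p = ((p : ℤ) - cT k e).natAbs + 1 + cG k e := by simp [cF, cG]
    by_cases h : e = 2 * k - 1
    · have : ((p : ℤ) - cT k e).natAbs + 1 ≤ 3 * k := by
        subst h; unfold cT; split_ifs <;> omega
      have := cG_last k hk
      rw [← h] at this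
      omega
    · have h3 := cG_mono k (show e ≤ 2 * k - 2 by omega)
      have h4 := cG_prev k hk
      obtain ⟨t1, t2⟩ := cT_range k e hk (by omega)
      omega

lemma far (k : ℕ) (hk : 1 ≤ k) : ∃ p, cR k k (k + 1) (2 * k) p ∧
    cF k (2 * k) p + 1 = 4 * k ^ 2 + 5 * k := by
  obtain ⟨e, he⟩ : ∃ e, 2 * k = e + 1 := ⟨2 * k - 1, by omega⟩
  have hg := cG_last k hk
  have he' : 2 * k - 1 = e := by omega
  rw [he'] at hg
  have hF : ∀ p, cF k (e + 1) p = ((p : ℤ) - cT k e).natAbs + 1 + cG k e := by simp [cF, cG]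
  rcases Nat.even_or_odd' k with ⟨j, hj | hj⟩
  · refine ⟨1, ⟨by omega, by omega, le_rfl, Or.inl ⟨0, ?_⟩, ⟨0, ?_⟩⟩, ?_⟩
    · unfold cX; push_cast; split_ifs <;> omega
    · unfold cX; push_cast; split_ifs <;> omega
    · rw [he, hF]
      have : ((1 : ℕ) - cT k e : ℤ).natAbs + 1 = 3 * k := by
        unfold cT; split_ifs <;> omega
      omega
  · refine ⟨4 * k + 1, ⟨by omega, by omega, le_rfl, Or.inr ⟨0, ?_⟩, ⟨2, ?_⟩⟩, ?_⟩
    · unfold cX; push_cast; split_ifs <;> omega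
    · unfold cX; push_cast; split_ifs <;> omega
    · rw [he, hF]
      have : ((4 * k + 1 : ℕ) - cT k e : ℤ).natAbs + 1 = 3 * k := by
        unfold cT; split_ifs <;> omega
      omega

lemma diam_eq (k : ℕ) (hk : 1 ≤ k) : sqDiam (On (4 * k + 1)) + 1 = 4 * k ^ 2 + 5 * k := by
  obtain ⟨p, hp, hF⟩ := far k hk
  rw [← hF]
  congr 1
  apply IsGreatest.csSup_eq
  constructor
  · refine ⟨(⟨k - 1, by omega⟩, ⟨k, by omega⟩), ?_, ?_⟩
    · simp only [ne_eq, Fin.mk.injEq]; omega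
    · apply dist_eq k hk
      have : k - 1 + 1 = k := by omega
      simpa only [this] using hp
  · rintro d ⟨u, -, rfl⟩
    obtain ⟨e, q, h⟩ := cR_exists k (u.1.val + 1) (u.2.val + 1) hk
    rw [dist_eq k hk e q u h]
    have := cF_le k e q hk h.2.2.1 h.1 h.2.1
    omega

/-- `h` is realized by a word. -/
def cW (k : ℕ) (h : Fin (4 * k + 1) → Fin (4 * k + 1)) : Prop :=
  ∃ ws : List (Matrix (Fin (4 * k + 1)) (Fin (4 * k + 1)) ℕ),
    (∀ A ∈ ws, A ∈ On (4 * k + 1)) ∧ ∀ i, 0 < ws.prod i (h i)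

lemma mul_pos_entry {n : ℕ} (A B : Matrix (Fin n) (Fin n) ℕ) (i j l : Fin n)
    (h1 : 0 < A i j) (h2 : 0 < B j l) : 0 < (A * B) i l := by
  rw [Matrix.mul_apply]
  exact Finset.sum_pos' (fun _ _ => Nat.zero_le _) ⟨j, Finset.mem_univ _, Nat.mul_pos h1 h2⟩

lemma cW_id (k : ℕ) : cW k id := ⟨[], by simp, by simp⟩

lemma cW_comp (k : ℕ) (g h : Fin (4 * k + 1) → Fin (4 * k + 1)) (hg : cW k g) (hh : cW k h) :
    cW k (h ∘ g) := by
  obtain ⟨w1, h1, h2⟩ := hg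
  obtain ⟨w2, h3, h4⟩ := hh
  refine ⟨w1 ++ w2, ?_, fun i => ?_⟩
  · intro A hA
    rcases List.mem_append.1 hA with hA | hA
    · exact h1 A hA
    · exact h3 A hA
  · rw [List.prod_append]
    exact mul_pos_entry _ _ _ _ _ (h2 i) (h4 (g i))

lemma cW_merge (k : ℕ) : ∀ (l : ℕ) (u : Fin (4 * k + 1) × Fin (4 * k + 1))
    (s : Fin (4 * k + 1)), stepsTo (sqStep (On (4 * k + 1))) l u (s, s) →
    ∃ h, cW k h ∧ h u.1 = h u.2 := by
  intro l
  induction l with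
  | zero =>
    intro u s hs
    simp only [stepsTo] at hs
    subst hs
    exact ⟨id, cW_id k, rfl⟩
  | succ l ih =>
    intro u s hs
    obtain ⟨v, ⟨A, hA, hv⟩, hs⟩ := hs
    obtain ⟨f, hf, rfl⟩ := (On_iff _ _).1 hA
    simp only [matOfFun_pos] at hv
    obtain ⟨g, hg⟩ := letter_fun k f hf
    obtain ⟨h, hh, he⟩ := ih v s hs
    refine ⟨h ∘ g, cW_comp k g h ⟨[matOfFun _ f], by simpa using hA, fun i => ?_⟩ hh, ?_⟩
    · simpa using (matOfFun_pos _ _ _ _).2 (hg i)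
    · simp only [hg] at hv
      simp only [Function.comp]
      rcases hv with ⟨h3, h4⟩ | ⟨h3, h4⟩
      · have e1 : g u.1 = v.1 := by ext; omega
        have e2 : g u.2 = v.2 := by ext; omega
        rw [e1, e2, he]
      · have e1 : g u.1 = v.2 := by ext; omega
        have e2 : g u.2 = v.1 := by ext; omega
        rw [e1, e2, he]

lemma cW_const (k : ℕ) (hk : 1 ≤ k) : ∀ (c : ℕ) (g : Fin (4 * k + 1) → Fin (4 * k + 1)),
    cW k g → (Finset.univ.image g).card ≤ c → ∃ h, cW k h ∧ ∀ x y, h x = h y := by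
  intro c
  induction c with
  | zero =>
    intro g _ hc
    have : g 0 ∈ Finset.univ.image g := Finset.mem_image_of_mem _ (Finset.mem_univ _)
    rw [Finset.card_eq_zero.1 (Nat.le_zero.1 hc)] at this
    simp at this
  | succ c ih =>
    intro g hg hc
    by_cases hcon : ∀ x y, g x = g y
    · exact ⟨g, hg, hcon⟩
    push Not at hcon
    obtain ⟨x, y, hxy⟩ := hcon
    obtain ⟨e, p, hr⟩ := cR_exists k ((g x).val + 1) ((g y).val + 1) hk
    obtain ⟨s, hs⟩ := upper k hk _ e p (g x) (g y) hr rfl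
    obtain ⟨h, hh, he⟩ := cW_merge k _ _ s hs
    refine ih (h ∘ g) (cW_comp k g h hg hh) ?_
    have : (Finset.univ.image (h ∘ g)) = (Finset.univ.image g).image h := by
      rw [Finset.image_image]
    rw [this]
    have hlt : ((Finset.univ.image g).image h).card < (Finset.univ.image g).card := by
      refine lt_of_le_of_ne Finset.card_image_le fun heq => ?_
      have := Finset.card_image_iff.1 heq
      exact hxy (this (by simp) (by simp) he)
    omega

lemma sync (k : ℕ) (hk : 1 ≤ k) : IsSync (On (4 * k + 1)) := by
  obtain ⟨h, ⟨ws, h1, h2⟩, hc⟩ := cW_const k hk _ id (cW_id k) le_rfl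
  refine ⟨ws, ?_, h1, h 0, fun i => ?_⟩
  · rintro rfl
    simp only [List.prod_nil] at h2
    have h3 : ∀ i, i = h i := by
      intro i
      by_contra hne
      have := h2 i
      rw [Matrix.one_apply_ne hne] at this
      exact lt_irrefl _ this
    have h4 : (⟨0, by omega⟩ : Fin (4 * k + 1)) = ⟨1, by omega⟩ := by
      rw [h3 ⟨0, by omega⟩, h3 ⟨1, by omega⟩]; exact hc _ _
    simp at h4
  · rw [hc 0 i]; exact h2 i

/-- For `n = 4k + 1`, `k ≥ 1`, the DFA `O_n = {Ī_{(n−1)/2,(n+1)/2}, Q₁, Q₂}` is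
synchronizing and the diameter of its square graph equals `(n² + 3n − 8)/4`. -/
theorem stmt18 (n k : ℕ) (hk : 1 ≤ k) (hn : n = 4 * k + 1) :
    IsSync (On n) ∧ 4 * sqDiam (On n) = n ^ 2 + 3 * n - 8 := by
  subst hn
  refine ⟨sync k hk, ?_⟩
  have h := diam_eq k hk
  have h2 : (4 * k + 1) ^ 2 = 16 * k ^ 2 + 8 * k + 1 := by ring
  rw [h2]
  omega
end

section
/- Let n = 4k + 3 with k ≥ 1 an integer. Let q_1 be the permutation of {1,...,n} with q_1(1)=1, q_1(i)=i+1 for even i, q_1(i)=i−1 for odd i with 3 ≤ i ≤ n, and q_2 the permutation with q_2(n)=n, q_2(i)=i−1 for even i, q_2(i)=i+1 for odd i with 1 ≤ i ≤ n−2; let Q_1, Q_2 be their permutation matrices. Let O'_n be the DFA with the three letters Ī_{(n−1)/2,(n+1)/2}, Q_1, Q_2, where Ī_{(n−1)/2,(n+1)/2} is the binary row-stochastic matrix of the map sending state (n−1)/2 to state (n+1)/2 and fixing every other state. Then O'_n is synchronizing, the diameter of its square graph S(O'_n) equals (n² + 3n − 6)/4, and consequently the reset threshold of O'_n is at least (n²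 + 3n − 6)/4. -/
open Matrix

/-- A DFA `S` has a synchronizing word of length `L`. -/
def SyncWordLen {n : ℕ} (S : Set (Matrix (Fin n) (Fin n) ℕ)) (L : ℕ) : Prop :=
  ∃ ws : List (Matrix (Fin n) (Fin n) ℕ), ws.length = L ∧ ws ≠ [] ∧
    (∀ A ∈ ws, A ∈ S) ∧ ∃ j, ∀ i, 0 < ws.prod i j

/-- The reset threshold of a (synchronizing) DFA `S`: the length of its shortest
synchronizing word. -/
noncomputable def rt {n : ℕ} (S : Set (Matrix (Fin n) (Fin n) ℕ)) : ℕ :=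
  sInf {L | SyncWordLen S L}

/-! ### Arithmetic of the pair coordinates -/

def q1f (s : ℕ) : ℕ := if s = 1 then 1 else if s % 2 = 0 then s + 1 else s - 1
def q2f (k s : ℕ) : ℕ := if s = 4 * k + 3 then 4 * k + 3 else if s % 2 = 0 then s - 1 else s + 1
def ibf (k s : ℕ) : ℕ := if s = 2 * k + 1 then 2 * k + 2 else s

/-- class of a pair -/
def cls (k i j : ℕ) : ℕ :=
  if (i + j) % 2 = 0 then
    (if (i - j) + (j - i) ≤ 2 * k + 1 then (i - j) + (j - i) else 4 * k + 3 - ((i - j) + (j - i)))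
  else if i + j ≤ 2 * k + 2 then i + j - 1
  else if i + j ≤ 4 * k + 4 then 4 * k + 4 - (i + j)
  else if i + j ≤ 6 * k + 5 then i + j - (4 * k + 4)
  else 8 * k + 7 - (i + j)

/-- position of a pair within its class -/
def tt (k i j : ℕ) : ℕ :=
  if (i + j) % 4 = 1 then ((i - j) + (j - i) - 1) / 2
  else if (i + j) % 4 = 3 then 4 * k + 3 - ((i - j) + (j - i) + 1) / 2
  else if ((i - j) + (j - i)) % 4 = 0 then (i + j) / 2 - 1
  else 4 * k + 3 - (i + j) / 2

/-- position at which a class is left downwards -/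
def dd (k c : ℕ) : ℕ :=
  if c % 4 = 0 then 2 * k + c / 2
  else if c % 4 = 2 then 2 * k + 2 - c / 2
  else if c % 4 = 3 then (c - 3) / 2
  else if c = 1 then 4 * k + 2 else 4 * k + 3 - (c - 1) / 2

/-- walking distance in a class from entry to exit -/
def wd (k c : ℕ) : ℕ :=
  if c = 1 then 4 * k + 2 else if c % 2 = 1 then 4 * k + 4 - c else c - 1

def EE (k : ℕ) : ℕ → ℕ
  | 0 => 0
  | c + 1 => EE k c + 1 + wd k (c + 1)

/-- distance to the exit -/
def ds (k i j : ℕ) : ℕ := (tt k i j - dd k (cls k i j)) + (dd k (cls k i j) - tt k i j)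

def ff (k i j : ℕ) : ℕ := if i = j then 0 else EE k (cls k i j - 1) + 1 + ds k i j

def gg (k i j : ℕ) : ℕ :=
  if i = j then 0 else EE k (cls k i j - 1) + 1 +
    (if cls k i j = 2 * k + 1 then ds k i j else min (ds k i j) (wd k (cls k i j)))

theorem cls_comm (k i j : ℕ) : cls k i j = cls k j i := by
  unfold cls; rw [add_comm i j, add_comm (i - j)]

theorem tt_comm (k i j : ℕ) : tt k i j = tt k j i := by
  unfold tt; rw [add_comm i j, add_comm (i - j)]

theorem ds_comm (k i j : ℕ) : ds k i j = ds k j i := by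
  unfold ds; rw [cls_comm, tt_comm]

theorem gg_comm (k i j : ℕ) : gg k i j = gg k j i := by
  unfold gg; rw [cls_comm, ds_comm]; simp only [eq_comm]

theorem ff_comm (k i j : ℕ) : ff k i j = ff k j i := by
  unfold ff; rw [cls_comm, ds_comm]; simp only [eq_comm]

theorem cls_pos {k i j : ℕ} (hi : 1 ≤ i) (hij : i < j) (hj : j ≤ 4 * k + 3) :
    1 ≤ cls k i j ∧ cls k i j ≤ 2 * k + 1 := by
  unfold cls; split_ifs <;> omega

theorem tt_le {k i j : ℕ} (hi : 1 ≤ i) (hij : i < j) (hj : j ≤ 4 * k + 3) :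
    tt k i j ≤ 4 * k + 2 := by
  unfold tt; split_ifs <;> omega

/-- the pair `i < j` has coordinates `a, t` -/
def PP (k a t i j : ℕ) : Prop :=
  1 ≤ a ∧ a ≤ 2 * k + 1 ∧ t ≤ 4 * k + 2 ∧ 1 ≤ i ∧ i < j ∧ j ≤ 4 * k + 3 ∧
  ((i + t = 2 * a ∧ j = 2 * a + 1 + t) ∨ (i + 2 * a = t + 1 ∧ j = 2 * a + 1 + t) ∨
   (i + t = 2 * a ∧ j + 2 * a + t = 8 * k + 6) ∨ (i + 2 * a = t + 1 ∧ j + 2 * a + t = 8 * k + 6))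

/-- class in terms of `a` -/
def ca (k a : ℕ) : ℕ :=
  if 4 * a ≤ 2 * k + 1 then 4 * a
  else if 4 * a ≤ 4 * k + 3 then 4 * k + 3 - 4 * a
  else if 4 * a ≤ 6 * k + 4 then 4 * a - (4 * k + 3)
  else 8 * k + 6 - 4 * a

theorem PP_ex {k i j : ℕ} (hi : 1 ≤ i) (hij : i < j) (hj : j ≤ 4 * k + 3) :
    ∃ a t, PP k a t i j := by
  have h4 : (i + j) % 4 = 1 ∨ (i + j) % 4 = 3 ∨ ((i + j) % 2 = 0 ∧ (j - i) % 4 = 0) ∨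
    ((i + j) % 2 = 0 ∧ (j - i) % 4 = 2) := by omega
  rcases h4 with h | h | h | h
  · exact ⟨(i + j) / 4, (j - i) / 2, by omega, by omega, by omega, hi, hij, hj, Or.inl (by omega)⟩
  · exact ⟨(8 * k + 7 - i - j) / 4, 4 * k + 3 - (j - i + 1) / 2, by omega, by omega, by omega, hi, hij,
      hj, Or.inr (Or.inr (Or.inr (by omega)))⟩
  · exact ⟨(j - i) / 4, (i + j) / 2 - 1, by omega, by omega, by omega, hi, hij, hj,
      Or.inr (Or.inl (by omega))⟩
  · exact ⟨(8 * k + 6 - (j - i)) / 4, 4 * k + 3 - (i + j) / 2, by omega, by omega, by omega, hi, hij,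
      hj, Or.inr (Or.inr (Or.inl (by omega)))⟩

theorem PP_tt {k a t i j : ℕ} (h : PP k a t i j) : tt k i j = t := by
  obtain ⟨h1, h2, h3, h4, h5, h6, h⟩ := h
  have e : (i - j) + (j - i) = j - i := by omega
  unfold tt
  rw [e]
  rcases h with h | h | h | h
  · rw [if_pos (by omega)]; omega
  · rw [if_neg (by omega), if_neg (by omega), if_pos (by omega)]; omega
  · rw [if_neg (by omega), if_neg (by omega), if_neg (by omega)]; omega
  · rw [if_neg (by omega), if_pos (by omega)]; omega

theorem PP_cls {k a t i j : ℕ} (h : PP k a t i j) : cls k i j = ca k a := by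
  obtain ⟨h1, h2, h3, h4, h5, h6, h⟩ := h
  have e : (i - j) + (j - i) = j - i := by omega
  unfold cls ca
  rw [e]
  rcases h with h | h | h | h
  · rw [if_neg (by omega)]; split_ifs <;> omega
  · rw [if_pos (by omega)]; split_ifs <;> omega
  · rw [if_pos (by omega)]; split_ifs <;> omega
  · rw [if_neg (by omega)]; split_ifs <;> omega

theorem PP_q1 {k a t i j : ℕ} (h : PP k a t i j) :
    (t = 0 ∧ q1f i = j ∧ q1f j = i) ∨
    PP k a (if t % 2 = 1 then t + 1 else t - 1) (q1f i) (q1f j) := by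
  obtain ⟨h1, h2, h3, h4, h5, h6, h⟩ := h
  rcases Nat.eq_zero_or_pos t with rfl | ht
  · left
    have : i = 2 * a ∧ j = 2 * a + 1 := by omega
    obtain ⟨rfl, rfl⟩ := this
    refine ⟨rfl, ?_, ?_⟩ <;> unfold q1f <;> split_ifs <;> omega
  right
  have ej : q1f j = if j % 2 = 0 then j + 1 else j - 1 := by
    unfold q1f; rw [if_neg (by omega)]
  rw [ej]
  unfold PP q1f
  rcases Nat.even_or_odd' t with ⟨b, hb | hb⟩
  · have e1 : ¬ t % 2 = 1 := by omega
    rw [if_neg e1]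
    clear ej
    rcases h with h | h | h | h <;> split_ifs <;> omega
  · have e1 : t % 2 = 1 := by omega
    rw [if_pos e1]
    clear ej
    rcases h with h | h | h | h <;> split_ifs <;> omega

theorem PP_q2 {k a t i j : ℕ} (h : PP k a t i j) :
    (t = 4 * k + 2 ∧ q2f k i = j ∧ q2f k j = i) ∨
    (PP k a (if t % 2 = 1 then t - 1 else t + 1) (q2f k i) (q2f k j)) := by
  obtain ⟨h1, h2, h3, h4, h5, h6, h⟩ := h
  by_cases ht : t = 4 * k + 2
  · left
    subst ht
    have : i = 4 * k + 3 - 2 * a ∧ j = 4 * k + 4 - 2 * a := by omega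
    obtain ⟨hi, hj⟩ := this
    refine ⟨rfl, ?_, ?_⟩ <;> unfold q2f <;> split_ifs <;> omega
  right
  have ei : q2f k i = if i % 2 = 0 then i - 1 else i + 1 := by
    unfold q2f; rw [if_neg (by omega)]
  rw [ei]
  unfold PP q2f
  rcases Nat.even_or_odd' t with ⟨b, hb | hb⟩
  · have e1 : ¬ t % 2 = 1 := by omega
    rw [if_neg e1]
    clear ei
    rcases h with h | h | h | h <;> split_ifs <;> omega
  · have e1 : t % 2 = 1 := by omega
    rw [if_pos e1]
    clear ei
    rcases h with h | h | h | h <;> split_ifs <;> omega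

theorem q1_cls {k i j : ℕ} (hi : 1 ≤ i) (hij : i < j) (hj : j ≤ 4 * k + 3) :
    cls k (q1f i) (q1f j) = cls k i j := by
  obtain ⟨a, t, h⟩ := PP_ex hi hij hj
  rcases PP_q1 h with ⟨_, h1, h2⟩ | h'
  · rw [h1, h2, cls_comm]
  · rw [PP_cls h', PP_cls h]

theorem q1_tt {k i j : ℕ} (hi : 1 ≤ i) (hij : i < j) (hj : j ≤ 4 * k + 3) :
    tt k (q1f i) (q1f j) = if tt k i j % 2 = 1 then tt k i j + 1 else tt k i j - 1 := by
  obtain ⟨a, t, h⟩ := PP_ex hi hij hj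
  rcases PP_q1 h with ⟨h0, h1, h2⟩ | h'
  · rw [h1, h2, tt_comm, PP_tt h, h0]; simp
  · rw [PP_tt h', PP_tt h]

theorem q2_cls {k i j : ℕ} (hi : 1 ≤ i) (hij : i < j) (hj : j ≤ 4 * k + 3) :
    cls k (q2f k i) (q2f k j) = cls k i j := by
  obtain ⟨a, t, h⟩ := PP_ex hi hij hj
  rcases PP_q2 h with ⟨_, h1, h2⟩ | h'
  · rw [h1, h2, cls_comm]
  · rw [PP_cls h', PP_cls h]

theorem q2_tt {k i j : ℕ} (hi : 1 ≤ i) (hij : i < j) (hj : j ≤ 4 * k + 3) :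
    tt k (q2f k i) (q2f k j) = if tt k i j % 2 = 1 then tt k i j - 1 else
      if tt k i j = 4 * k + 2 then 4 * k + 2 else tt k i j + 1 := by
  obtain ⟨a, t, h⟩ := PP_ex hi hij hj
  rcases PP_q2 h with ⟨h0, h1, h2⟩ | h'
  · rw [h1, h2, tt_comm, PP_tt h, h0, if_neg (by omega), if_pos rfl]
  · have := h'.2.2.1
    rw [PP_tt h', PP_tt h]
    split_ifs at this ⊢ <;> omega

/-- a pair at exit position contains the state `2k+1` and goes down -/
theorem exit_mem {k i j : ℕ} (hi : 1 ≤ i) (hij : i < j) (hj : j ≤ 4 * k + 3)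
    (h : tt k i j = dd k (cls k i j)) : i = 2 * k + 1 ∨ j = 2 * k + 1 := by
  obtain ⟨a, t, hp⟩ := PP_ex hi hij hj
  rw [PP_tt hp, PP_cls hp] at h
  obtain ⟨c, hc⟩ : ∃ c, c = ca k a := ⟨_, rfl⟩
  rw [← hc] at h
  obtain ⟨h1, h2, h3, h4, h5, h6, hp⟩ := hp
  unfold ca at hc
  unfold dd at h
  split_ifs at hc
  · rw [if_pos (by omega)] at h
    rcases hp with hp | hp | hp | hp <;> omega
  · rw [if_neg (by omega), if_neg (by omega)] at h
    split_ifs at h <;> rcases hp with hp | hp | hp | hp <;> omega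
  · rw [if_neg (by omega), if_neg (by omega)] at h
    split_ifs at h <;> rcases hp with hp | hp | hp | hp <;> omega
  · rw [if_neg (by omega), if_pos (by omega)] at h
    rcases hp with hp | hp | hp | hp <;> omega

theorem tt_1 {k i j : ℕ} (hij : i ≤ j) (h : (i + j) % 4 = 1) : tt k i j = (j - i - 1) / 2 := by
  have e : (i - j) + (j - i) = j - i := by omega
  unfold tt; rw [e, if_pos h]

theorem tt_3 {k i j : ℕ} (hij : i ≤ j) (h : (i + j) % 4 = 3) :
    tt k i j = 4 * k + 3 - (j - i + 1) / 2 := by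
  have e : (i - j) + (j - i) = j - i := by omega
  unfold tt; rw [e, if_neg (by omega), if_pos h]

theorem tt_0 {k i j : ℕ} (hij : i ≤ j) (h : (j - i) % 4 = 0) : tt k i j = (i + j) / 2 - 1 := by
  have e : (i - j) + (j - i) = j - i := by omega
  unfold tt; rw [e, if_neg (by omega), if_neg (by omega), if_pos h]

theorem tt_2 {k i j : ℕ} (hij : i ≤ j) (h : (j - i) % 4 = 2) :
    tt k i j = 4 * k + 3 - (i + j) / 2 := by
  have e : (i - j) + (j - i) = j - i := by omega
  unfold tt; rw [e, if_neg (by omega), if_neg (by omega), if_neg (by omega)]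

theorem dd_0 {k c : ℕ} (h : c % 4 = 0) : dd k c = 2 * k + c / 2 := by
  unfold dd; rw [if_pos h]

theorem dd_2 {k c : ℕ} (h : c % 4 = 2) : dd k c = 2 * k + 2 - c / 2 := by
  unfold dd; rw [if_neg (by omega), if_pos h]

theorem dd_3 {k c : ℕ} (h : c % 4 = 3) : dd k c = (c - 3) / 2 := by
  unfold dd; rw [if_neg (by omega), if_neg (by omega), if_pos h]

theorem dd_1 {k c : ℕ} (h : c % 4 = 1) (h1 : c ≠ 1) : dd k c = 4 * k + 3 - (c - 1) / 2 := by
  unfold dd; rw [if_neg (by omega), if_neg (by omega), if_neg (by omega), if_neg h1]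

theorem dd_one {k : ℕ} : dd k 1 = 4 * k + 2 := by
  unfold dd; simp

theorem wd_one {k : ℕ} : wd k 1 = 4 * k + 2 := by
  unfold wd; simp

theorem wd_odd {k c : ℕ} (h : c % 2 = 1) (h1 : c ≠ 1) : wd k c = 4 * k + 4 - c := by
  unfold wd; rw [if_neg h1, if_pos h]

theorem wd_even {k c : ℕ} (h : c % 2 = 0) : wd k c = c - 1 := by
  unfold wd; rw [if_neg (by omega), if_neg (by omega)]

set_option maxHeartbeats 4000000 in
/-- effect of the merging letter on a pair containing `2k+1` -/
theorem ib_eff {k j : ℕ} (hk : 1 ≤ k) (h1 : 1 ≤ j) (hj : j ≤ 4 * k + 3) (hne : j ≠ 2 * k + 1) :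
    (tt k (2 * k + 1) j = dd k (cls k (2 * k + 1) j) ∧ cls k (2 * k + 1) j = 1 ∧ j = 2 * k + 2) ∨
    (tt k (2 * k + 1) j = dd k (cls k (2 * k + 1) j) ∧ j ≠ 2 * k + 2 ∧ 2 ≤ cls k (2 * k + 1) j ∧
      cls k (2 * k + 2) j = cls k (2 * k + 1) j - 1 ∧ ds k (2 * k + 2) j = wd k (cls k (2 * k + 2) j)) ∨
    (tt k (2 * k + 1) j ≠ dd k (cls k (2 * k + 1) j) ∧ j ≠ 2 * k + 2 ∧ cls k (2 * k + 1) j < 2 * k + 1 ∧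
      cls k (2 * k + 2) j = cls k (2 * k + 1) j + 1) ∨
    (tt k (2 * k + 1) j ≠ dd k (cls k (2 * k + 1) j) ∧ j ≠ 2 * k + 2 ∧ cls k (2 * k + 1) j = 2 * k + 1 ∧
      cls k (2 * k + 2) j = 2 * k + 1 ∧
      (tt k (2 * k + 2) j = tt k (2 * k + 1) j + 1 ∨ tt k (2 * k + 1) j = tt k (2 * k + 2) j + 1)) := by
  have key : ∀ c c' t t' d d' w', cls k (2 * k + 1) j = c → cls k (2 * k + 2) j = c' →
      tt k (2 * k + 1) j = t → tt k (2 * k + 2) j = t' → dd k c = d → dd k c' = d' → wd k c' = w' →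
      ((t = d ∧ c = 1 ∧ j = 2 * k + 2) ∨
        (t = d ∧ j ≠ 2 * k + 2 ∧ 2 ≤ c ∧ c' = c - 1 ∧ (t' - d') + (d' - t') = w') ∨
        (t ≠ d ∧ j ≠ 2 * k + 2 ∧ c < 2 * k + 1 ∧ c' = c + 1) ∨
        (t ≠ d ∧ j ≠ 2 * k + 2 ∧ c = 2 * k + 1 ∧ c' = 2 * k + 1 ∧ (t' = t + 1 ∨ t = t' + 1))) := by
    intro c c' t t' d d' w' hc hc' ht ht' hd hd' hw'
    rcases Nat.even_or_odd' j with ⟨b, hb | hb⟩ <;> rcases lt_or_ge b (k + 2) with hlt | hge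
    · -- even, small
      have e1 : c = 2 * k + 3 - j := by rw [← hc]; unfold cls; split_ifs <;> omega
      have e2 : c' = 2 * k + 2 - j := by rw [← hc']; unfold cls; split_ifs <;> omega
      clear hc hc'
      by_cases hbk : b = k + 1
      · left
        have : c = 1 := by omega
        subst this
        rw [dd_one] at hd
        rw [tt_3 (by omega) (by omega)] at ht
        omega
      right; left
      rw [tt_comm] at ht ht'
      rw [wd_even (by omega)] at hw'
      rcases Nat.even_or_odd' (k - b) with ⟨e, he | he⟩
      · rw [dd_3 (by omega)] at hd
        rw [dd_2 (by omega)] at hd'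
        rw [tt_1 (by omega) (by omega)] at ht
        rw [tt_2 (by omega) (by omega)] at ht'
        omega
      · rw [dd_1 (by omega) (by omega)] at hd
        rw [dd_0 (by omega)] at hd'
        rw [tt_3 (by omega) (by omega)] at ht
        rw [tt_0 (by omega) (by omega)] at ht'
        omega
    · have e1 : c = j - (2 * k + 3) := by rw [← hc]; unfold cls; split_ifs <;> omega
      have e2 : c' = j - (2 * k + 2) := by rw [← hc']; unfold cls; split_ifs <;> omega
      clear hc hc' ht' hd' hw'
      right; right; left
      rcases Nat.even_or_odd' (b - k) with ⟨e, he | he⟩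
      · by_cases h1 : c = 1
        · subst h1
          rw [dd_one] at hd
          rw [tt_1 (by omega) (by omega)] at ht
          omega
        · rw [dd_1 (by omega) (by omega)] at hd
          rw [tt_1 (by omega) (by omega)] at ht
          omega
      · rw [dd_3 (by omega)] at hd
        rw [tt_3 (by omega) (by omega)] at ht
        omega
    · have hlt2 : b < k ∨ b = k + 1 := by omega
      rcases hlt2 with hlt2 | hlt2
      · have e1 : c = 2 * k + 1 - j := by rw [← hc]; unfold cls; split_ifs <;> omega
        have e2 : c' = 2 * k + 2 - j := by rw [← hc']; unfold cls; split_ifs <;> omega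
        clear hc hc' ht' hd' hw'
        right; right; left
        rw [tt_comm] at ht
        rcases Nat.even_or_odd' (k - b) with ⟨e, he | he⟩
        · rw [dd_0 (by omega)] at hd
          rw [tt_0 (by omega) (by omega)] at ht
          omega
        · rw [dd_2 (by omega)] at hd
          rw [tt_2 (by omega) (by omega)] at ht
          omega
      · have e1 : c = 2 := by rw [← hc]; unfold cls; split_ifs <;> omega
        have e2 : c' = 1 := by rw [← hc']; unfold cls; split_ifs <;> omega
        clear hc hc'
        subst e1 e2
        rw [dd_2 (by omega)] at hd
        rw [dd_one] at hd'
        rw [wd_one] at hw'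
        rw [tt_2 (by omega) (by omega)] at ht
        rw [tt_1 (by omega) (by omega)] at ht'
        omega
    · have hge2 : b ≤ 2 * k ∨ b = 2 * k + 1 := by omega
      rcases hge2 with hge2 | hge2
      · have e1 : c = j - (2 * k + 1) := by rw [← hc]; unfold cls; split_ifs <;> omega
        have e2 : c' = j - (2 * k + 2) := by rw [← hc']; unfold cls; split_ifs <;> omega
        clear hc hc'
        right; left
        rw [wd_odd (by omega) (by omega)] at hw'
        rcases Nat.even_or_odd' (b - k) with ⟨e, he | he⟩
        · rw [dd_0 (by omega)] at hd
          rw [dd_3 (by omega)] at hd'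
          rw [tt_0 (by omega) (by omega)] at ht
          rw [tt_3 (by omega) (by omega)] at ht'
          omega
        · rw [dd_2 (by omega)] at hd
          rw [dd_1 (by omega) (by omega)] at hd'
          rw [tt_2 (by omega) (by omega)] at ht
          rw [tt_1 (by omega) (by omega)] at ht'
          omega
      · have e1 : c = 2 * k + 1 := by rw [← hc]; unfold cls; split_ifs <;> omega
        have e2 : c' = 2 * k + 1 := by rw [← hc']; unfold cls; split_ifs <;> omega
        clear hc hc' hd' hw'
        right; right; right
        rcases Nat.even_or_odd' k with ⟨e, he | he⟩
        · rw [dd_1 (by omega) (by omega)] at hd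
          rw [tt_2 (by omega) (by omega)] at ht
          rw [tt_1 (by omega) (by omega)] at ht'
          omega
        · rw [dd_3 (by omega)] at hd
          rw [tt_0 (by omega) (by omega)] at ht
          rw [tt_3 (by omega) (by omega)] at ht'
          omega
  exact key _ _ _ _ _ _ _ rfl rfl rfl rfl rfl rfl rfl
theorem EE_pred {k c : ℕ} (h : 1 ≤ c) : EE k c = EE k (c - 1) + 1 + wd k c := by
  obtain ⟨d, rfl⟩ : ∃ d, c = d + 1 := ⟨c - 1, by omega⟩
  rfl

theorem gg_near {k i j i' j' : ℕ} (hne' : i' ≠ j') (hc : cls k i' j' = cls k i j)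
    (ht : tt k i j ≤ tt k i' j' + 1 ∧ tt k i' j' ≤ tt k i j + 1) : gg k i j ≤ gg k i' j' + 1 := by
  by_cases hne : i = j
  · unfold gg; rw [if_pos hne]; omega
  · unfold gg ds
    rw [if_neg hne, if_neg hne', hc]
    split_ifs <;> omega

theorem q1_inj {k i j : ℕ} (hi : 1 ≤ i) (hij : i < j) (hj : j ≤ 4 * k + 3) : q1f i ≠ q1f j := by
  unfold q1f; split_ifs <;> omega

theorem q2_inj {k i j : ℕ} (hi : 1 ≤ i) (hij : i < j) (hj : j ≤ 4 * k + 3) : q2f k i ≠ q2f k j := by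
  unfold q2f; split_ifs <;> omega

theorem gg_q1 {k i j : ℕ} (hi : 1 ≤ i) (hij : i < j) (hj : j ≤ 4 * k + 3) :
    gg k i j ≤ gg k (q1f i) (q1f j) + 1 := by
  apply gg_near (q1_inj hi hij hj) (q1_cls hi hij hj)
  rw [q1_tt hi hij hj]; split_ifs <;> omega

theorem gg_q2 {k i j : ℕ} (hi : 1 ≤ i) (hij : i < j) (hj : j ≤ 4 * k + 3) :
    gg k i j ≤ gg k (q2f k i) (q2f k j) + 1 := by
  apply gg_near (q2_inj hi hij hj) (q2_cls hi hij hj)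
  rw [q2_tt hi hij hj]; split_ifs <;> omega

theorem gg_ib_p {k j : ℕ} (hk : 1 ≤ k) (h1 : 1 ≤ j) (hj : j ≤ 4 * k + 3) (hne : j ≠ 2 * k + 1) :
    gg k (2 * k + 1) j ≤ gg k (2 * k + 2) j + 1 := by
  rcases ib_eff hk h1 hj hne with ⟨a, b, c⟩ | ⟨a, b, c, d, e⟩ | ⟨a, b, c, d⟩ | ⟨a, b, c, d, e⟩
  · have hd : ds k (2 * k + 1) j = 0 := by unfold ds; omega
    unfold gg
    rw [if_neg hne.symm, hd, b, if_neg (by omega)]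
    simp [EE]
  · have hd : ds k (2 * k + 1) j = 0 := by unfold ds; omega
    have hm : cls k (2 * k + 1) j ≤ 2 * k + 1 := by
      rcases lt_or_gt_of_ne hne with h | h
      · rw [cls_comm]; exact (cls_pos h1 h (by omega)).2
      · exact (cls_pos (by omega) h hj).2
    have hE := EE_pred (k := k) (c := cls k (2 * k + 1) j - 1) (by omega)
    unfold gg
    rw [if_neg hne.symm, if_neg (Ne.symm b), hd, e, d, if_neg (c := _ - 1 = _) (by omega)]
    split_ifs <;> omega
  · have hp : 1 ≤ cls k (2 * k + 1) j := by
      rcases lt_or_gt_of_ne hne with h | h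
      · rw [cls_comm]; exact (cls_pos h1 h (by omega)).1
      · exact (cls_pos (by omega) h hj).1
    have hE := EE_pred (k := k) (c := cls k (2 * k + 1) j) (by omega)
    unfold gg
    rw [if_neg hne.symm, if_neg (Ne.symm b), d, if_neg (c := cls k (2 * k + 1) j = _) (by omega),
      Nat.add_sub_cancel]
    omega
  · apply gg_near (Ne.symm b) (by omega)
    omega

theorem gg_ib {k i j : ℕ} (hk : 1 ≤ k) (hi : 1 ≤ i) (hij : i < j) (hj : j ≤ 4 * k + 3) :
    gg k i j ≤ gg k (ibf k i) (ibf k j) + 1 := by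
  unfold ibf
  split_ifs with h1 h2 h2
  · omega
  · subst h1; exact gg_ib_p hk (by omega) hj h2
  · subst h2; rw [gg_comm, gg_comm k i]; exact gg_ib_p hk hi (by omega) h1
  · omega

theorem ds_pos_step {k i j : ℕ} (hi : 1 ≤ i) (hij : i < j) (hj : j ≤ 4 * k + 3)
    (h : tt k i j ≠ dd k (cls k i j)) :
    ff k (q1f i) (q1f j) + 1 = ff k i j ∨ ff k (q2f k i) (q2f k j) + 1 = ff k i j := by
  have hD : dd k (cls k i j) ≤ 4 * k + 2 := by
    have := cls_pos hi hij hj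
    unfold dd; split_ifs <;> omega
  have hT := tt_le hi hij hj
  unfold ff ds
  rw [if_neg (q1_inj hi hij hj), if_neg (q2_inj hi hij hj), if_neg hij.ne, q1_cls hi hij hj,
    q2_cls hi hij hj, q1_tt hi hij hj, q2_tt hi hij hj]
  generalize tt k i j = t at *
  generalize dd k (cls k i j) = d at *
  split_ifs <;> omega

theorem ff_ib_p {k j : ℕ} (hk : 1 ≤ k) (h1 : 1 ≤ j) (hj : j ≤ 4 * k + 3) (hne : j ≠ 2 * k + 1)
    (h : tt k (2 * k + 1) j = dd k (cls k (2 * k + 1) j)) :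
    ff k (2 * k + 2) j + 1 = ff k (2 * k + 1) j := by
  have hd : ds k (2 * k + 1) j = 0 := by unfold ds; omega
  rcases ib_eff hk h1 hj hne with ⟨a, b, c⟩ | ⟨a, b, c, d, e⟩ | ⟨a, b, c, d⟩ | ⟨a, b, c, d, e⟩
  · unfold ff
    rw [if_neg hne.symm, hd, b, if_pos c.symm]
    simp [EE]
  · have hE := EE_pred (k := k) (c := cls k (2 * k + 1) j - 1) (by omega)
    unfold ff
    rw [if_neg hne.symm, if_neg (Ne.symm b), hd, e, d]
    omega
  · exact absurd h a
  · exact absurd h a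

/-- every pair admits a letter decreasing `ff` -/
theorem ff_step {k i j : ℕ} (hk : 1 ≤ k) (hi : 1 ≤ i) (hij : i < j) (hj : j ≤ 4 * k + 3) :
    ff k (q1f i) (q1f j) + 1 = ff k i j ∨ ff k (q2f k i) (q2f k j) + 1 = ff k i j ∨
    ff k (ibf k i) (ibf k j) + 1 = ff k i j := by
  by_cases h : tt k i j = dd k (cls k i j)
  · right; right
    rcases exit_mem hi hij hj h with h1 | h1
    · subst h1
      have : ibf k j = j := by unfold ibf; rw [if_neg (by omega)]
      rw [this]
      have : ibf k (2 * k + 1) = 2 * k + 2 := by unfold ibf; rw [if_pos rfl]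
      rw [this]
      exact ff_ib_p hk (by omega) hj (by omega) h
    · subst h1
      have : ibf k i = i := by unfold ibf; rw [if_neg (by omega)]
      rw [this]
      have : ibf k (2 * k + 1) = 2 * k + 2 := by unfold ibf; rw [if_pos rfl]
      rw [this, ff_comm, ff_comm k i]
      rw [tt_comm, cls_comm] at h
      exact ff_ib_p hk hi (by omega) (by omega) h
  · rcases ds_pos_step hi hij hj h with h | h
    · exact Or.inl h
    · exact Or.inr (Or.inl h)

theorem EE_even (k b : ℕ) (hb : b ≤ k) (hk : 1 ≤ b) :
    EE k (2 * b) + 1 = b * (4 * k + 6) := by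
  induction b, hk using Nat.le_induction with
  | base =>
    have h1 : wd k 2 = 1 := by unfold wd; simp
    have h2 : wd k 1 = 4 * k + 2 := wd_one
    have h3 : EE k (2 * 1) = 0 + 1 + wd k 1 + 1 + wd k 2 := rfl
    omega
  | succ b hb1 ih =>
    have := ih (by omega)
    have h1 : wd k (2 * b + 2) = 2 * b + 2 - 1 := wd_even (by omega)
    have h2 : wd k (2 * b + 1) = 4 * k + 4 - (2 * b + 1) := wd_odd (by omega) (by omega)
    have h3 : EE k (2 * (b + 1)) = EE k (2 * b) + 1 + wd k (2 * b + 1) + 1 + wd k (2 * b + 2) := rfl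
    rw [add_mul, ← this, h3, h1, h2]
    omega

theorem EE_mono (k : ℕ) {a b : ℕ} (h : a ≤ b) : EE k a ≤ EE k b := by
  apply monotone_nat_of_le_succ (f := EE k) _ h
  intro n; rw [EE]; omega

theorem ds_m {k i j : ℕ} (hk : 1 ≤ k) (hi : 1 ≤ i) (hij : i < j) (hj : j ≤ 4 * k + 3)
    (hc : cls k i j = 2 * k + 1) : ds k i j ≤ 3 * k + 3 := by
  have hT := tt_le hi hij hj
  unfold ds
  rw [hc]
  rcases Nat.even_or_odd' k with ⟨e, he | he⟩
  · rw [dd_1 (by omega) (by omega)]; omega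
  · rw [dd_3 (by omega)]; omega

theorem ff_le {k i j : ℕ} (hk : 1 ≤ k) (hi : 1 ≤ i) (hij : i < j) (hj : j ≤ 4 * k + 3) :
    ff k i j ≤ EE k (2 * k) + 3 * k + 4 := by
  have hc := cls_pos hi hij hj
  unfold ff
  rw [if_neg hij.ne]
  by_cases h1 : cls k i j = 2 * k + 1
  · have := ds_m hk hi hij hj h1
    rw [h1, Nat.add_sub_cancel]
    omega
  have hT := tt_le hi hij hj
  have hD : dd k (cls k i j) ≤ 4 * k + 2 := by
    unfold dd; split_ifs <;> omega
  have hds : ds k i j ≤ 4 * k + 2 := by unfold ds; omega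
  have e1 := EE_pred (k := k) (c := 2 * k) (by omega)
  rw [wd_even (by omega)] at e1
  have e2 := EE_mono k (show cls k i j - 1 ≤ 2 * k - 1 by omega)
  omega

theorem gg_start {k : ℕ} (hk : 1 ≤ k) :
    gg k (3 * k + 2) (3 * k + 3) = EE k (2 * k) + 3 * k + 4 := by
  have hc : cls k (3 * k + 2) (3 * k + 3) = 2 * k + 1 := by
    unfold cls; split_ifs <;> omega
  unfold gg ds
  rw [if_neg (by omega), hc, if_pos rfl, Nat.add_sub_cancel]
  rcases Nat.even_or_odd' k with ⟨e, he | he⟩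
  · rw [dd_1 (by omega) (by omega), tt_1 (by omega) (by omega)]; omega
  · rw [dd_3 (by omega), tt_3 (by omega) (by omega)]; omega

theorem total {k : ℕ} (hk : 1 ≤ k) :
    4 * (EE k (2 * k) + 3 * k + 4) = (4 * k + 3) ^ 2 + 3 * (4 * k + 3) - 6 := by
  have := EE_even k k le_rfl hk
  have h2 : (4 * k + 3) ^ 2 + 3 * (4 * k + 3) = 4 * (k * (4 * k + 6)) + 12 * k + 18 := by ring
  omega

/-! ### From arithmetic to matrices -/

def IsL (k : ℕ) (f : ℕ → ℕ) : Prop := f = q1f ∨ f = q2f k ∨ f = ibf k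

theorem mem_On {k : ℕ} {A : Matrix (Fin (4 * k + 3)) (Fin (4 * k + 3)) ℕ} :
    A ∈ On (4 * k + 3) ↔ ∃ f, IsL k f ∧ A = matOfFun (4 * k + 3) f := by
  have h1 : Q1mat (4 * k + 3) = matOfFun (4 * k + 3) q1f := rfl
  have h2 : Q2mat (4 * k + 3) = matOfFun (4 * k + 3) (q2f k) := rfl
  have h3 : IbarMat (4 * k + 3) = matOfFun (4 * k + 3) (ibf k) := by
    unfold IbarMat
    congr 1
    funext s
    unfold ibf
    rw [show (4 * k + 3 - 1) / 2 = 2 * k + 1 by omega, show (4 * k + 3 + 1) / 2 = 2 * k + 2 by omega]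
  unfold On IsL
  simp only [Set.mem_insert_iff, Set.mem_singleton_iff, h1, h2, h3]
  constructor
  · rintro (h | h | h)
    · exact ⟨_, Or.inr (Or.inr rfl), h⟩
    · exact ⟨_, Or.inl rfl, h⟩
    · exact ⟨_, Or.inr (Or.inl rfl), h⟩
  · rintro ⟨f, rfl | rfl | rfl, h⟩
    · exact Or.inr (Or.inl h)
    · exact Or.inr (Or.inr h)
    · exact Or.inl h

theorem mat_pos {n : ℕ} {f : ℕ → ℕ} {a b : Fin n} :
    0 < matOfFun n f a b ↔ f (a.val + 1) = b.val + 1 := by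
  unfold matOfFun
  rw [Matrix.of_apply]
  split_ifs with h <;> simp [h]

theorem IsL_range {k s : ℕ} {f : ℕ → ℕ} (hf : IsL k f) (h1 : 1 ≤ s) (h2 : s ≤ 4 * k + 3) :
    1 ≤ f s ∧ f s ≤ 4 * k + 3 := by
  rcases hf with rfl | rfl | rfl
  · unfold q1f; split_ifs <;> omega
  · unfold q2f; split_ifs <;> omega
  · unfold ibf; split_ifs <;> omega

theorem mat_total {k : ℕ} {f : ℕ → ℕ} (hf : IsL k f) (a : Fin (4 * k + 3)) :
    ∃ b : Fin (4 * k + 3), f (a.val + 1) = b.val + 1 := by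
  have := IsL_range hf (s := a.val + 1) (by omega) (by omega)
  exact ⟨⟨f (a.val + 1) - 1, by omega⟩, by simp only; omega⟩

theorem gg_L {k i j : ℕ} {f : ℕ → ℕ} (hk : 1 ≤ k) (hf : IsL k f) (hi : 1 ≤ i) (hi' : i ≤ 4 * k + 3)
    (hj : 1 ≤ j) (hj' : j ≤ 4 * k + 3) : gg k i j ≤ gg k (f i) (f j) + 1 := by
  have main : ∀ i j, 1 ≤ i → i < j → j ≤ 4 * k + 3 → gg k i j ≤ gg k (f i) (f j) + 1 := by
    intro i j h1 h2 h3
    rcases hf with rfl | rfl | rfl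
    · exact gg_q1 h1 h2 h3
    · exact gg_q2 h1 h2 h3
    · exact gg_ib hk h1 h2 h3
  rcases lt_trichotomy i j with h | h | h
  · exact main i j hi h hj'
  · unfold gg; rw [if_pos h]; omega
  · rw [gg_comm, gg_comm k (f i)]; exact main j i hj h hi'

theorem ff_L {k i j : ℕ} (hk : 1 ≤ k) (hne : i ≠ j) (hi : 1 ≤ i) (hi' : i ≤ 4 * k + 3)
    (hj : 1 ≤ j) (hj' : j ≤ 4 * k + 3) : ∃ f, IsL k f ∧ ff k (f i) (f j) + 1 = ff k i j := by
  have main : ∀ i j, 1 ≤ i → i < j → j ≤ 4 * k + 3 →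
      ∃ f, IsL k f ∧ ff k (f i) (f j) + 1 = ff k i j := by
    intro i j h1 h2 h3
    rcases ff_step hk h1 h2 h3 with h | h | h
    · exact ⟨_, Or.inl rfl, h⟩
    · exact ⟨_, Or.inr (Or.inl rfl), h⟩
    · exact ⟨_, Or.inr (Or.inr rfl), h⟩
  rcases lt_or_gt_of_ne hne with h | h
  · exact main i j hi h hj'
  · obtain ⟨f, hf, e⟩ := main j i hj h hi'
    exact ⟨f, hf, by rw [ff_comm, e, ff_comm]⟩

theorem mul_pos_iff' {n : ℕ} {A B : Matrix (Fin n) (Fin n) ℕ} {i j : Fin n} :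
    0 < (A * B) i j ↔ ∃ x, 0 < A i x ∧ 0 < B x j := by
  rw [Matrix.mul_apply, Finset.sum_pos_iff]
  simp [Nat.mul_pos_iff_of_pos_left, Nat.pos_iff_ne_zero]

theorem word_steps {n : ℕ} {S : Set (Matrix (Fin n) (Fin n) ℕ)} (j : Fin n) :
    ∀ (ws : List (Matrix (Fin n) (Fin n) ℕ)), (∀ A ∈ ws, A ∈ S) → ∀ a b : Fin n,
      0 < ws.prod a j → 0 < ws.prod b j → stepsTo (sqStep S) ws.length (a, b) (j, j) := by
  intro ws
  induction ws with
  | nil =>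
    intro _ a b ha hb
    rw [List.prod_nil, Matrix.one_apply] at ha hb
    have h1 : a = j := by by_contra h; rw [if_neg h] at ha; omega
    have h2 : b = j := by by_contra h; rw [if_neg h] at hb; omega
    subst h1 h2
    rfl
  | cons A ws ih =>
    intro hS a b ha hb
    rw [List.prod_cons, mul_pos_iff'] at ha hb
    obtain ⟨x, hx, hx'⟩ := ha
    obtain ⟨y, hy, hy'⟩ := hb
    exact ⟨(x, y), ⟨A, hS A (by simp), Or.inl ⟨hx, hy⟩⟩,
      ih (fun B hB => hS B (by simp [hB])) x y hx' hy'⟩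

theorem steps_gg {k : ℕ} (hk : 1 ≤ k) (s : Fin (4 * k + 3)) : ∀ (L : ℕ)
    (u : Fin (4 * k + 3) × Fin (4 * k + 3)),
    stepsTo (sqStep (On (4 * k + 3))) L u (s, s) → gg k (u.1.val + 1) (u.2.val + 1) ≤ L := by
  intro L
  induction L with
  | zero =>
    intro u h
    have h : u = (s, s) := h
    subst h
    simp [gg]
  | succ L ih =>
    rintro u ⟨v, ⟨A, hA, hAv⟩, hv⟩
    have h1 := ih v hv
    obtain ⟨f, hf, rfl⟩ := mem_On.1 hA
    have h2 := gg_L hk hf (i := u.1.val + 1) (j := u.2.val + 1) (by omega) (by omega) (by omega)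
      (by omega)
    rcases hAv with ⟨ha, hb⟩ | ⟨ha, hb⟩
    · rw [mat_pos] at ha hb
      rw [ha, hb] at h2
      omega
    · rw [mat_pos] at ha hb
      rw [ha, hb, gg_comm k (v.2.val + 1)] at h2
      omega

theorem merge_word {k : ℕ} (hk : 1 ≤ k) : ∀ (N : ℕ) (a b : Fin (4 * k + 3)),
    ff k (a.val + 1) (b.val + 1) = N →
    ∃ ws : List (Matrix (Fin (4 * k + 3)) (Fin (4 * k + 3)) ℕ), ws.length = N ∧
      (∀ A ∈ ws, A ∈ On (4 * k + 3)) ∧ ∃ c, 0 < ws.prod a c ∧ 0 < ws.prod b c := by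
  intro N
  induction N with
  | zero =>
    intro a b h
    have : a = b := by
      by_contra hne
      have hv : a.val ≠ b.val := fun h => hne (Fin.ext h)
      unfold ff at h
      rw [if_neg (by omega)] at h
      omega
    subst this
    exact ⟨[], rfl, by simp, a, by simp, by simp⟩
  | succ N ih =>
    intro a b h
    have hne : a.val + 1 ≠ b.val + 1 := by
      intro e; unfold ff at h; rw [if_pos e] at h; omega
    obtain ⟨f, hf, e⟩ := ff_L hk hne (by omega) (by omega) (by omega) (by omega)
    obtain ⟨a', ha'⟩ := mat_total hf a
    obtain ⟨b', hb'⟩ := mat_total hf b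
    rw [ha', hb', h] at e
    obtain ⟨ws, hl, hS, c, h1, h2⟩ := ih a' b' (by omega)
    refine ⟨matOfFun _ f :: ws, by simp [hl], ?_, c, ?_, ?_⟩
    · intro A hA
      rcases List.mem_cons.1 hA with rfl | hA
      · exact mem_On.2 ⟨f, hf, rfl⟩
      · exact hS A hA
    · rw [List.prod_cons, mul_pos_iff']; exact ⟨a', mat_pos.2 ha', h1⟩
    · rw [List.prod_cons, mul_pos_iff']; exact ⟨b', mat_pos.2 hb', h2⟩

theorem word_total {k : ℕ} : ∀ ws : List (Matrix (Fin (4 * k + 3)) (Fin (4 * k + 3)) ℕ),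
    (∀ A ∈ ws, A ∈ On (4 * k + 3)) → ∀ a, ∃ b, 0 < ws.prod a b := by
  intro ws
  induction ws with
  | nil => intro _ a; exact ⟨a, by simp⟩
  | cons A ws ih =>
    intro hS a
    obtain ⟨f, hf, rfl⟩ := mem_On.1 (hS A (by simp))
    obtain ⟨x, hx⟩ := mat_total hf a
    obtain ⟨b, hb⟩ := ih (fun B hB => hS B (by simp [hB])) x
    exact ⟨b, by rw [List.prod_cons, mul_pos_iff']; exact ⟨x, mat_pos.2 hx, hb⟩⟩

theorem sync_set {k : ℕ} (hk : 1 ≤ k) : ∀ (N : ℕ) (S : Finset (Fin (4 * k + 3))), S.card ≤ N →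
    ∃ ws : List (Matrix (Fin (4 * k + 3)) (Fin (4 * k + 3)) ℕ),
      (∀ A ∈ ws, A ∈ On (4 * k + 3)) ∧ ∃ j, ∀ i ∈ S, 0 < ws.prod i j := by
  classical
  intro N
  induction N with
  | zero =>
    intro S hS
    have : S = ∅ := Finset.card_eq_zero.1 (by omega)
    subst this
    exact ⟨[], by simp, ⟨0, by omega⟩, by simp⟩
  | succ N ih =>
    intro S hS
    by_cases h1 : S.card ≤ 1
    · rw [Finset.card_le_one_iff_subset_singleton] at h1
      obtain ⟨x, hx⟩ := h1
      refine ⟨[], by simp, x, fun i hi => ?_⟩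
      have := Finset.mem_singleton.1 (hx hi)
      subst this
      simp
    · obtain ⟨a, ha, b, hb, hab⟩ := Finset.one_lt_card.1 (not_le.1 h1)
      obtain ⟨ws, -, hw, c, hac, hbc⟩ := merge_word hk _ a b rfl
      choose g hg using word_total ws hw
      let φ : Fin (4 * k + 3) → Fin (4 * k + 3) := fun x => if x = a ∨ x = b then c else g x
      have hφ : ∀ x, 0 < ws.prod x (φ x) := by
        intro x
        simp only [φ]
        split_ifs with h
        · rcases h with rfl | rfl
          · exact hac
          · exact hbc
        · exact hg x
      have hcard : (S.image φ).card < S.card := by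
        refine lt_of_le_of_ne Finset.card_image_le fun e => ?_
        exact hab (Finset.card_image_iff.1 e ha hb (by simp [φ]))
      obtain ⟨ws', hw', j, hj⟩ := ih (S.image φ) (by omega)
      refine ⟨ws ++ ws', ?_, j, fun i hi => ?_⟩
      · intro A hA
        rcases List.mem_append.1 hA with h | h
        · exact hw A h
        · exact hw' A h
      · rw [List.prod_append, mul_pos_iff']
        exact ⟨φ i, hφ i, hj _ (Finset.mem_image_of_mem φ hi)⟩

theorem sync_On {k : ℕ} (hk : 1 ≤ k) : IsSync (On (4 * k + 3)) := by
  obtain ⟨ws, hw, j, hj⟩ := sync_set hk _ Finset.univ le_rfl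
  refine ⟨ws, ?_, hw, j, fun i => hj i (Finset.mem_univ i)⟩
  rintro rfl
  have h0 := hj ⟨0, by omega⟩ (Finset.mem_univ _)
  have h1 := hj ⟨1, by omega⟩ (Finset.mem_univ _)
  have := word_steps j [] (S := ∅) (by simp) _ _ h0 h1
  have h : ((⟨0, by omega⟩, ⟨1, by omega⟩) : Fin (4 * k + 3) × Fin (4 * k + 3)) = (j, j) := this
  have e1 := congrArg (fun p => p.1.val) h
  have e2 := congrArg (fun p => p.2.val) h
  simp only at e1 e2
  omega

theorem dist_mem {k : ℕ} (hk : 1 ≤ k) (u : Fin (4 * k + 3) × Fin (4 * k + 3)) :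
    ff k (u.1.val + 1) (u.2.val + 1) ∈
      {L | ∃ s : Fin (4 * k + 3), stepsTo (sqStep (On (4 * k + 3))) L u (s, s)} := by
  obtain ⟨ws, hl, hw, c, h1, h2⟩ := merge_word hk _ u.1 u.2 rfl
  have := word_steps c ws hw _ _ h1 h2
  rw [hl] at this
  exact ⟨c, this⟩

theorem dist_le {k : ℕ} (hk : 1 ≤ k) (u : Fin (4 * k + 3) × Fin (4 * k + 3)) :
    sqDistToSingleton (On (4 * k + 3)) u ≤ ff k (u.1.val + 1) (u.2.val + 1) :=
  Nat.sInf_le (dist_mem hk u)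

theorem le_dist {k : ℕ} (hk : 1 ≤ k) (u : Fin (4 * k + 3) × Fin (4 * k + 3)) :
    gg k (u.1.val + 1) (u.2.val + 1) ≤ sqDistToSingleton (On (4 * k + 3)) u := by
  obtain ⟨s, hs⟩ := Nat.sInf_mem ⟨_, dist_mem hk u⟩
  exact steps_gg hk s _ u hs

theorem dist_bound {k : ℕ} (hk : 1 ≤ k) (u : Fin (4 * k + 3) × Fin (4 * k + 3)) (hu : u.1 ≠ u.2) :
    sqDistToSingleton (On (4 * k + 3)) u ≤ EE k (2 * k) + 3 * k + 4 := by
  refine (dist_le hk u).trans ?_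
  have hv : u.1.val ≠ u.2.val := fun h => hu (Fin.ext h)
  rcases lt_or_gt_of_ne hv with h | h
  · exact ff_le hk (by omega) (by omega) (by omega)
  · rw [ff_comm]; exact ff_le hk (by omega) (by omega) (by omega)

theorem diam_On {k : ℕ} (hk : 1 ≤ k) : sqDiam (On (4 * k + 3)) = EE k (2 * k) + 3 * k + 4 := by
  apply IsGreatest.csSup_eq
  constructor
  · refine ⟨(⟨3 * k + 1, by omega⟩, ⟨3 * k + 2, by omega⟩), ?_, ?_⟩
    · intro h
      have := congrArg Fin.val h
      simp only at this
      omega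
    · apply le_antisymm
      · apply dist_bound hk
        intro h
        have := congrArg Fin.val h
        simp only at this
        omega
      · rw [← gg_start hk]
        exact le_dist hk (⟨3 * k + 1, by omega⟩, ⟨3 * k + 2, by omega⟩)
  · rintro d ⟨u, hu, rfl⟩
    exact dist_bound hk u hu

theorem rt_On {k : ℕ} (hk : 1 ≤ k) : EE k (2 * k) + 3 * k + 4 ≤ rt (On (4 * k + 3)) := by
  obtain ⟨ws, h1, h2, h3⟩ := sync_On hk
  obtain ⟨vs, hl, -, hS, j, hj⟩ : SyncWordLen (On (4 * k + 3)) (rt (On (4 * k + 3))) :=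
    Nat.sInf_mem (s := {L | SyncWordLen (On (4 * k + 3)) L}) ⟨ws.length, ws, rfl, h1, h2, h3⟩
  have := word_steps j vs hS ⟨3 * k + 1, by omega⟩ ⟨3 * k + 2, by omega⟩ (hj _) (hj _)
  have := steps_gg hk j _ _ this
  rw [hl] at this
  rw [← gg_start hk]
  exact this

/-- For `n = 4k + 3`, `k ≥ 1`, the DFA `O'_n = {Ī_{(n−1)/2,(n+1)/2}, Q₁, Q₂}` is
synchronizing, the diameter of its square graph equals `(n² + 3n − 6)/4`, and consequently
its reset threshold is at least `(n² + 3n − 6)/4`. -/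
theorem stmt19 (n k : ℕ) (hk : 1 ≤ k) (hn : n = 4 * k + 3) :
    IsSync (On n) ∧ 4 * sqDiam (On n) = n ^ 2 + 3 * n - 6 ∧
      n ^ 2 + 3 * n - 6 ≤ 4 * rt (On n) := by
  subst hn
  refine ⟨sync_On hk, ?_, ?_⟩
  · rw [diam_On hk, total hk]
  · rw [← total hk]
    have := rt_On hk
    omega
end
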